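/- Tame estimates for the ordinary differential equation governing the divergence (Lemma 12.2): Let x : [0,T]×Ω → ℝⁿ be smooth with invertible Jacobian satisfying the coordinate condition with constant c₁, with T < 1; let σ = ln κ and σ̈ = D_t² σ. Suppose φ, f : [0,T]×Ω → ℝ are smooth, D_t² φ + σ̈ φ = f on [0,T]×Ω, and φ|_{t=0} = D_t φ|_{t=0} = 0. Set M̈_s = sup_{0≤t≤T}(‖x(t,·)‖_{3+s,∞} + ‖D_t x(t,·)‖_{2+s,∞} + ‖D_t² x(t,·)‖_{1+s,∞}). Then for every r ≥ 1 and 0 ≤ t ≤ T there is a constant K depending only on n, r, c₁ and an upper bound for M̈₀ such that ‖D_t φ(t,·)‖_{r−1} + ‖φ(t,·)‖_{r−1} ≤ K Σ_{s=0}^{r−1} M̈_{r−1−s} ∫₀^t ‖f(τ,·)‖_s dτ and ‖D_t² φ(t,·)‖_{r−1} ≤ K Σ_{s=0}^{r−1} M̈_{r−1−s} (‖f(t,·)‖_s + ∫₀^t ‖f(τ,·)‖_s dτ). -/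

import Mathlib

open scoped BigOperators
open Set Matrix

noncomputable section

abbrev E' (n : ℕ) := EuclideanSpace ℝ (Fin n)

def Ball (n : ℕ) : Set (E' n) := Metric.closedBall 0 1

def Sphere' (n : ℕ) : Set (E' n) := Metric.sphere 0 1

variable {n : ℕ} {F : Type*} [NormedAddCommGroup F] [NormedSpace ℝ F]

/-- Partial derivative `∂u/∂y^a`. -/
def pd (a : Fin n) (u : E' n → ℝ) (y : E' n) : ℝ :=
  fderiv ℝ u y (EuclideanSpace.single a 1)

/-- Jacobian matrix `∂x^i/∂y^a`. -/
def jacM (x : E' n → E' n) (y : E' n) : Matrix (Fin n) (Fin n) ℝ :=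
  Matrix.of fun i a => pd a (fun z => x z i) y

/-- Metric `g_{ab} = Σ_i (∂x^i/∂y^a)(∂x^i/∂y^b)`. -/
def gMet (x : E' n → E' n) (y : E' n) : Matrix (Fin n) (Fin n) ℝ :=
  (jacM x y)ᵀ * jacM x y

def kappa (x : E' n → E' n) (y : E' n) : ℝ := (jacM x y).det

/-- Eulerian derivative `∂_i u = (∂y^a/∂x^i) ∂_a u`. -/
def epd (x : E' n → E' n) (i : Fin n) (u : E' n → ℝ) (y : E' n) : ℝ :=
  ∑ a, (jacM x y)⁻¹ a i * pd a u y

/-- Laplace–Beltrami operator `Δq = κ⁻¹ ∂_a (κ g^{ab} ∂_b q)`. -/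
def lapl (x : E' n → E' n) (q : E' n → ℝ) (y : E' n) : ℝ :=
  (kappa x y)⁻¹ *
    ∑ a, pd a (fun z => kappa x z * ∑ b, (gMet x z)⁻¹ a b * pd b q z) y

/-- Lagrangian divergence `div W = κ⁻¹ ∂_a (κ W^a)`. -/
def divL (x : E' n → E' n) (W : E' n → Fin n → ℝ) (y : E' n) : ℝ :=
  (kappa x y)⁻¹ * ∑ a, pd a (fun z => kappa x z * W z a) y

/-- Eulerian divergence `div u = ∂_k u^k`. -/
def divE (x : E' n → E' n) (u : E' n → Fin n → ℝ) (y : E' n) : ℝ :=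
  ∑ k, epd x k (fun z => u z k) y

/-- Eulerian curl `curl u_{ij} = ∂_i u_j − ∂_j u_i`. -/
def curlE (x : E' n → E' n) (u : E' n → Fin n → ℝ) (i j : Fin n) (y : E' n) : ℝ :=
  epd x i (fun z => u z j) y - epd x j (fun z => u z i) y

/-- Exterior unit (with respect to `g`) normal derivative on the unit sphere. -/
def gradN (x : E' n → E' n) (p : E' n → ℝ) (y : E' n) : ℝ :=
  (∑ a, ∑ b, (gMet x y)⁻¹ a b * y b * pd a p y) /
    Real.sqrt (∑ a, ∑ b, (gMet x y)⁻¹ a b * y a * y b)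

/-- Coordinate condition `|∂x/∂y|² + |∂y/∂x|² ≤ c₁²`. -/
def coordCond (x : E' n → E' n) (c₁ : ℝ) (y : E' n) : Prop :=
  (∑ i, ∑ a, (jacM x y i a) ^ 2) + (∑ i, ∑ a, ((jacM x y)⁻¹ i a) ^ 2) ≤ c₁ ^ 2

/-- Physical condition `∇_N p ≤ −c₀` on the boundary. -/
def physCond (x : E' n → E' n) (p : E' n → ℝ) (c₀ : ℝ) : Prop :=
  ∀ y ∈ Sphere' n, gradN x p y ≤ -c₀

/-- Material (time) derivative at fixed `y`. -/
def Dt (u : ℝ → E' n → F) : ℝ → E' n → F := fun t y => deriv (fun s => u s y) t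

/-- Iterated time derivative. -/
def Dts (k : ℕ) (u : ℝ → E' n → F) : ℝ → E' n → F := Dt^[k] u

/-- Joint space-time smoothness. -/
def SmoothST (u : ℝ → E' n → F) : Prop :=
  ContDiff ℝ (⊤ : ℕ∞) fun p : ℝ × E' n => u p.1 p.2

/-- `L²` Sobolev norm of order `r` on the unit ball. -/
def sobNorm (r : ℕ) (u : E' n → F) : ℝ :=
  ∑ j ∈ Finset.range (r + 1), (∫ y in Ball n, ‖iteratedFDeriv ℝ j u y‖ ^ 2) ^ ((1:ℝ)/2)

/-- `C^k` supremum norm on the unit ball. -/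
def ckNorm (k : ℕ) (u : E' n → F) : ℝ :=
  ∑ j ∈ Finset.range (k + 1), ⨆ y ∈ Ball n, ‖iteratedFDeriv ℝ j u y‖

/-- Hölder norm of order `a` on the set `s`. -/
def holderNormOn (s : Set (E' n)) (a : ℝ) (u : E' n → F) : ℝ :=
  if a ≤ 0 then ⨆ y ∈ s, ‖u y‖
  else
    (⨆ z ∈ s, ⨆ w ∈ s,
        ‖iteratedFDeriv ℝ (⌈a⌉₊ - 1) u z - iteratedFDeriv ℝ (⌈a⌉₊ - 1) u w‖ /
          ‖z - w‖ ^ (a - ((⌈a⌉₊ : ℝ) - 1))) +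
      ⨆ y ∈ s, ‖u y‖

/-- Hölder norm of order `a` on the unit ball. -/
def holderNorm (a : ℝ) (u : E' n → F) : ℝ := holderNormOn (Ball n) a u

/-- Space-time norm `|||u|||_{a,k}`. -/
def stNorm (T : ℝ) (a : ℝ) (k : ℕ) (u : ℝ → E' n → F) : ℝ :=
  ⨆ t ∈ Icc (0:ℝ) T, ∑ j ∈ Finset.range (k + 1), holderNorm a fun y => Dts j u t y

/-- The defining property of the pressure `p = Ψ(x)`:
`Δp = −(∂_i V^k)(∂_k V^i)` in `Ω`, `p = 0` on `∂Ω`. -/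
def IsPressure (x v : E' n → E' n) (p : E' n → ℝ) : Prop :=
  ContDiff ℝ (⊤ : ℕ∞) p ∧ (∀ y ∈ Sphere' n, p y = 0) ∧
    ∀ y ∈ Ball n,
      lapl x p y = -∑ i, ∑ k, epd x i (fun z => v z k) y * epd x k (fun z => v z i) y

/-- The pressure, selected by choice. -/
def pressureFn (x v : E' n → E' n) : E' n → ℝ := Classical.epsilon (IsPressure x v)

/-- The Euler map `Φ(x)_i = D_t² x_i + ∂_i p`. -/
def eulerMap (x : ℝ → E' n → E' n) : ℝ → E' n → Fin n → ℝ := fun t y i =>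
  Dts 2 x t y i + epd (x t) i (pressureFn (x t) (Dt x t)) y

/-- First variational derivative `Φ'(x)δx`. -/
def eulerMap' (x δx : ℝ → E' n → E' n) : ℝ → E' n → Fin n → ℝ := fun t y i =>
  deriv (fun r : ℝ => eulerMap (fun s z => x s z + r • δx s z) t y i) 0

/-- Second variational derivative `Φ''(x)(δx, εx)`. -/
def eulerMap'' (x δx εx : ℝ → E' n → E' n) : ℝ → E' n → Fin n → ℝ := fun t y i =>
  deriv (fun r : ℝ =>
    deriv (fun s : ℝ => eulerMap (fun τ z => x τ z + r • δx τ z + s • εx τ z) t y i) 0) 0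

/-- Modified linearized operator `L₁ δx = Φ'(x)δx − δx^k ∂_k Φ^i + δx^i div Φ`. -/
def modLin (x δx : ℝ → E' n → E' n) : ℝ → E' n → Fin n → ℝ := fun t y i =>
  eulerMap' x δx t y i
    - (∑ k, δx t y k * epd (x t) k (fun z => eulerMap x t z i) y)
    + δx t y i * ∑ k, epd (x t) k (fun z => eulerMap x t z k) y


/-- `M̈_s = sup_{0≤t≤T}(‖x(t)‖_{3+s,∞} + ‖D_t x(t)‖_{2+s,∞} + ‖D_t² x(t)‖_{1+s,∞})`. -/
def Mdd (T : ℝ) (x : ℝ → E' n → E' n) (s : ℕ) : ℝ :=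
  ⨆ t ∈ Icc (0:ℝ) T,
    (ckNorm (3 + s) (x t) + ckNorm (2 + s) (Dt x t) + ckNorm (1 + s) (Dts 2 x t))


section TimeCalculus

theorem SmoothST.contDiff_slice {u : ℝ → E' n → F} (hu : SmoothST u) (t : ℝ) :
    ContDiff ℝ (⊤ : ℕ∞) (u t) :=
  ContDiff.comp (g := fun p : ℝ × E' n => u p.1 p.2) hu (contDiff_prodMk_right t)

theorem SmoothST.contDiff_time {u : ℝ → E' n → F} (hu : SmoothST u) (y : E' n) :
    ContDiff ℝ (⊤ : ℕ∞) (fun t => u t y) :=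
  ContDiff.comp (g := fun p : ℝ × E' n => u p.1 p.2) hu (contDiff_prodMk_left y)

theorem SmoothST.hasDerivAt {u : ℝ → E' n → F} (hu : SmoothST u) (t : ℝ) (y : E' n) :
    HasDerivAt (fun s => u s y) (Dt u t y) t :=
  ((hu.contDiff_time y).differentiable (by simp) t).hasDerivAt

theorem SmoothST.Dt_eq {u : ℝ → E' n → F} (hu : SmoothST u) (t : ℝ) (y : E' n) :
    Dt u t y = fderiv ℝ (fun p : ℝ × E' n => u p.1 p.2) (t, y) (1, 0) := by
  have h1 : HasFDerivAt (fun p : ℝ × E' n => u p.1 p.2)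
      (fderiv ℝ (fun p : ℝ × E' n => u p.1 p.2) (t, y)) (t, y) :=
    (ContDiff.differentiable hu (by simp) (t, y)).hasFDerivAt
  have h2 : HasDerivAt (fun s : ℝ => (s, y)) ((1 : ℝ), (0 : E' n)) t :=
    (hasDerivAt_id t).prodMk (hasDerivAt_const t y)
  have h3 := HasFDerivAt.comp_hasDerivAt (f := fun s : ℝ => (s, y)) t h1 h2
  exact (hu.hasDerivAt t y).unique h3

theorem SmoothST.fderiv_eq {u : ℝ → E' n → F} (hu : SmoothST u) (t : ℝ) (y : E' n) :
    fderiv ℝ (u t) y =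
      (fderiv ℝ (fun p : ℝ × E' n => u p.1 p.2) (t, y)).comp
        (ContinuousLinearMap.inr ℝ ℝ (E' n)) := by
  have h1 : HasFDerivAt (fun p : ℝ × E' n => u p.1 p.2)
      (fderiv ℝ (fun p : ℝ × E' n => u p.1 p.2) (t, y)) (t, y) :=
    (ContDiff.differentiable hu (by simp) (t, y)).hasFDerivAt
  exact (HasFDerivAt.comp y h1 (hasFDerivAt_prodMk_right t y)).fderiv

theorem SmoothST.Dt {u : ℝ → E' n → F} (hu : SmoothST u) : SmoothST (Dt u) := by
  have h : (fun p : ℝ × E' n => _root_.Dt u p.1 p.2) =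
      fun p => fderiv ℝ (fun p : ℝ × E' n => u p.1 p.2) p (1, 0) := by
    ext p
    exact hu.Dt_eq p.1 p.2
  unfold SmoothST
  rw [h]
  exact (ContDiff.fderiv_right (m := (⊤ : ℕ∞)) hu (by simp)).clm_apply contDiff_const

theorem SmoothST.fderiv {u : ℝ → E' n → F} (hu : SmoothST u) :
    SmoothST (fun t y => fderiv ℝ (u t) y) := by
  have h : (fun p : ℝ × E' n => _root_.fderiv ℝ (u p.1) p.2) =
      fun p => (_root_.fderiv ℝ (fun p : ℝ × E' n => u p.1 p.2) p).comp
        (ContinuousLinearMap.inr ℝ ℝ (E' n)) := by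
    ext1 p
    exact hu.fderiv_eq p.1 p.2
  unfold SmoothST
  rw [h]
  exact (ContDiff.fderiv_right (m := (⊤ : ℕ∞)) hu (by simp)).clm_comp contDiff_const

theorem SmoothST.Dt_fderiv {u : ℝ → E' n → F} (hu : SmoothST u) :
    _root_.Dt (fun t y => _root_.fderiv ℝ (u t) y) =
      fun t y => _root_.fderiv ℝ (_root_.Dt u t) y := by
  funext t y
  set V : ℝ × E' n → F := fun p => u p.1 p.2 with hV
  have hVs : ContDiff ℝ (⊤ : ℕ∞) V := hu
  have hdV : ContDiff ℝ (⊤ : ℕ∞) (_root_.fderiv ℝ V) := ContDiff.fderiv_right hVs (by simp)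
  have hd2 : HasFDerivAt (_root_.fderiv ℝ V) (_root_.fderiv ℝ (_root_.fderiv ℝ V) (t, y)) (t, y) :=
    (hdV.differentiable (by simp) _).hasFDerivAt
  have hs : IsSymmSndFDerivAt ℝ V (t, y) :=
    hVs.contDiffAt.isSymmSndFDerivAt (by
      rw [minSmoothness_of_isRCLikeNormedField]
      exact WithTop.coe_le_coe.2 (le_top : (2 : ℕ∞) ≤ ⊤))
  have hL : _root_.Dt (fun t y => _root_.fderiv ℝ (u t) y) t y =
      (_root_.fderiv ℝ (_root_.fderiv ℝ V) (t, y) (1, 0)).comp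
        (ContinuousLinearMap.inr ℝ ℝ (E' n)) := by
    have h2 : HasDerivAt (fun s : ℝ => (s, y)) ((1 : ℝ), (0 : E' n)) t :=
      (hasDerivAt_id t).prodMk (hasDerivAt_const t y)
    have h4 : (fun s => _root_.fderiv ℝ (u s) y) = fun s =>
        ((ContinuousLinearMap.compL ℝ (E' n) (ℝ × E' n) F).flip
          (ContinuousLinearMap.inr ℝ ℝ (E' n))) (_root_.fderiv ℝ V (s, y)) := by
      funext s
      exact hu.fderiv_eq s y
    have h3 := HasFDerivAt.comp_hasDerivAt (f := fun s : ℝ => (s, y)) t hd2 h2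
    have h5 := ((ContinuousLinearMap.compL ℝ (E' n) (ℝ × E' n) F).flip
          (ContinuousLinearMap.inr ℝ ℝ (E' n))).hasFDerivAt.comp_hasDerivAt t h3
    change deriv (fun s => _root_.fderiv ℝ (u s) y) t = _
    rw [h4]
    exact h5.deriv
  have hR : HasFDerivAt (_root_.Dt u t)
      (((ContinuousLinearMap.apply ℝ F ((1 : ℝ), (0 : E' n))).comp
        (_root_.fderiv ℝ (_root_.fderiv ℝ V) (t, y))).comp
        (ContinuousLinearMap.inr ℝ ℝ (E' n))) y := by
    have h4 : _root_.Dt u t = fun z =>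
        (ContinuousLinearMap.apply ℝ F ((1 : ℝ), (0 : E' n))) (_root_.fderiv ℝ V (t, z)) := by
      funext z
      exact hu.Dt_eq t z
    rw [h4]
    exact ((ContinuousLinearMap.apply ℝ F ((1 : ℝ), (0 : E' n))).hasFDerivAt.comp (t, y) hd2).comp y
      (hasFDerivAt_prodMk_right t y)
  rw [hL, hR.fderiv]
  ext w
  simpa using hs.eq (1, 0) (0, w)

theorem SmoothST.clm_comp {G : Type*} [NormedAddCommGroup G] [NormedSpace ℝ G]
    {u : ℝ → E' n → F} (hu : SmoothST u) (L : F →L[ℝ] G) : SmoothST (fun t y => L (u t y)) :=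
  L.contDiff.comp hu

theorem SmoothST.Dt_clm_comp {G : Type*} [NormedAddCommGroup G] [NormedSpace ℝ G]
    {u : ℝ → E' n → F} (hu : SmoothST u) (L : F →L[ℝ] G) :
    _root_.Dt (fun t y => L (u t y)) = fun t y => L (_root_.Dt u t y) := by
  funext t y
  exact (L.hasFDerivAt.comp_hasDerivAt t (hu.hasDerivAt t y)).deriv

theorem SmoothST.iteratedFDeriv {u : ℝ → E' n → F} (hu : SmoothST u) (j : ℕ) :
    SmoothST (fun t y => iteratedFDeriv ℝ j (u t) y) ∧
      _root_.Dt (fun t y => _root_.iteratedFDeriv ℝ j (u t) y) =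
        fun t y => _root_.iteratedFDeriv ℝ j (_root_.Dt u t) y := by
  induction j with
  | zero =>
    have h : ∀ v : E' n → F, _root_.iteratedFDeriv ℝ 0 v = fun y =>
        ((continuousMultilinearCurryFin0 ℝ (E' n) F).symm.toContinuousLinearEquiv :
          F →L[ℝ] _) (v y) := fun v => by
      rw [iteratedFDeriv_zero_eq_comp]; rfl
    simp only [h]
    exact ⟨hu.clm_comp _, hu.Dt_clm_comp _⟩
  | succ j ih =>
    have h : ∀ v : E' n → F, _root_.iteratedFDeriv ℝ (j + 1) v = fun y =>
        ((continuousMultilinearCurryLeftEquiv ℝ (fun _ : Fin (j + 1) =>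
          E' n) F).symm.toContinuousLinearEquiv : _ →L[ℝ] _)
          (_root_.fderiv ℝ (_root_.iteratedFDeriv ℝ j v) y) := fun v => by
      rw [iteratedFDeriv_succ_eq_comp_left]; rfl
    simp only [h]
    have h1 := ih.1.fderiv
    have h2 := ih.1.Dt_fderiv
    refine ⟨h1.clm_comp _, ?_⟩
    rw [h1.Dt_clm_comp, h2]
    funext t y
    have h3 : _root_.iteratedFDeriv ℝ j (_root_.Dt u t) =
        _root_.Dt (fun t y => _root_.iteratedFDeriv ℝ j (u t) y) t := by rw [ih.2]
    rw [h3]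

theorem SmoothST.hasDerivAt_iteratedFDeriv {u : ℝ → E' n → F} (hu : SmoothST u) (j : ℕ)
    (t : ℝ) (y : E' n) :
    HasDerivAt (fun s => _root_.iteratedFDeriv ℝ j (u s) y)
      (_root_.iteratedFDeriv ℝ j (_root_.Dt u t) y) t := by
  have h := (hu.iteratedFDeriv j).1.hasDerivAt t y
  rwa [(hu.iteratedFDeriv j).2] at h

theorem SmoothST.continuous_norm_iteratedFDeriv {u : ℝ → E' n → F} (hu : SmoothST u) (j : ℕ) :
    Continuous fun p : ℝ × E' n => ‖_root_.iteratedFDeriv ℝ j (u p.1) p.2‖ :=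
  (ContDiff.continuous (hu.iteratedFDeriv j).1).norm

end TimeCalculus

section SupNorms

theorem le_biSup_of_le {X : Type*} {s : Set X} {g : X → ℝ} {C : ℝ} (h0 : ∀ x ∈ s, 0 ≤ g x)
    (hg : ∀ x ∈ s, g x ≤ C) {x : X} (hx : x ∈ s) : g x ≤ ⨆ y ∈ s, g y := by
  have hC : 0 ≤ C := (h0 x hx).trans (hg x hx)
  have hb : BddAbove (range fun y => ⨆ (_ : y ∈ s), g y) := by
    refine ⟨C, ?_⟩
    rintro _ ⟨y, rfl⟩
    exact Real.iSup_le (fun hy => hg y hy) hC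
  have h := le_ciSup hb x
  rwa [ciSup_pos hx] at h

theorem Real.biSup_le {X : Type*} {s : Set X} {g : X → ℝ} {C : ℝ} (hC : 0 ≤ C)
    (hg : ∀ x ∈ s, g x ≤ C) : ⨆ y ∈ s, g y ≤ C :=
  Real.iSup_le (fun y => Real.iSup_le (fun hy => hg y hy) hC) hC

theorem Real.biSup_nonneg {X : Type*} {s : Set X} {g : X → ℝ} (hg : ∀ x ∈ s, 0 ≤ g x) :
    0 ≤ ⨆ y ∈ s, g y :=
  Real.iSup_nonneg fun y => Real.iSup_nonneg fun hy => hg y hy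

/-- Supremum over the unit ball of the norm of the `j`-th derivative. -/
def derivSup (j : ℕ) (u : E' n → F) : ℝ := ⨆ y ∈ Ball n, ‖iteratedFDeriv ℝ j u y‖

theorem derivSup_nonneg (j : ℕ) (u : E' n → F) : 0 ≤ derivSup j u :=
  Real.biSup_nonneg fun _ _ => norm_nonneg _

theorem isCompact_Ball (n : ℕ) : IsCompact (Ball n) := isCompact_closedBall _ _

theorem zero_mem_Ball (n : ℕ) : (0 : E' n) ∈ Ball n := by simp [Ball]

theorem norm_iteratedFDeriv_le_derivSup {u : E' n → F} (hu : ContDiff ℝ (⊤ : ℕ∞) u) (j : ℕ)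
    {y : E' n} (hy : y ∈ Ball n) : ‖iteratedFDeriv ℝ j u y‖ ≤ derivSup j u := by
  obtain ⟨C, hC⟩ := (isCompact_Ball n).exists_bound_of_continuousOn
    (hu.continuous_iteratedFDeriv (m := j) (by exact_mod_cast le_top)).continuousOn
  exact le_biSup_of_le (fun _ _ => norm_nonneg _) hC hy

theorem ckNorm_nonneg (k : ℕ) (u : E' n → F) : 0 ≤ ckNorm k u :=
  Finset.sum_nonneg fun j _ => derivSup_nonneg j u

theorem ckNorm_succ (k : ℕ) (u : E' n → F) :
    ckNorm (k + 1) u = ckNorm k u + derivSup (k + 1) u := Finset.sum_range_succ _ _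

theorem ckNorm_mono {k l : ℕ} (h : k ≤ l) (u : E' n → F) : ckNorm k u ≤ ckNorm l u :=
  Finset.sum_le_sum_of_subset_of_nonneg (Finset.range_mono (by omega))
    fun j _ _ => derivSup_nonneg j u

theorem derivSup_le_ckNorm {j k : ℕ} (h : j ≤ k) (u : E' n → F) : derivSup j u ≤ ckNorm k u :=
  Finset.single_le_sum (f := fun j => derivSup j u) (fun j _ => derivSup_nonneg j u)
    (Finset.mem_range.2 (by omega))

theorem norm_iteratedFDeriv_sub_le {u : E' n → F} (hu : ContDiff ℝ (⊤ : ℕ∞) u) (j : ℕ)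
    {y z : E' n} (hy : y ∈ Ball n) (hz : z ∈ Ball n) :
    ‖iteratedFDeriv ℝ j u z - iteratedFDeriv ℝ j u y‖ ≤ derivSup (j + 1) u * ‖z - y‖ := by
  refine Convex.norm_image_sub_le_of_norm_fderiv_le (s := Ball n) (𝕜 := ℝ) (fun w _ => ?_)
    (fun w hw => ?_) (convex_closedBall _ _) hy hz
  · exact hu.differentiable_iteratedFDeriv (by exact_mod_cast WithTop.coe_lt_top j) w
  · rw [norm_fderiv_iteratedFDeriv]
    exact norm_iteratedFDeriv_le_derivSup hu _ hw

theorem norm_fderiv_apply_sub_le {u : E' n → F} (hu : ContDiff ℝ (⊤ : ℕ∞) u) (j : ℕ)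
    {y z : E' n} (hy : y ∈ Ball n) (hz : z ∈ Ball n) {h : ℝ} (h0 : 0 ≤ h) (h1 : h ≤ 1) :
    h * ‖fderiv ℝ (iteratedFDeriv ℝ j u) y (z - y)‖ ≤
      2 * derivSup j u + 4 * derivSup (j + 2) u * h ^ 2 := by
  set w : E' n := y + h • (z - y) with hw
  have hwB : w ∈ Ball n := (convex_closedBall _ _).add_smul_sub_mem hy hz ⟨h0, h1⟩
  have hzy : ‖z - y‖ ≤ 2 := by
    have h2 : ‖z‖ ≤ 1 := by simpa [Ball] using hz
    have h3 : ‖y‖ ≤ 1 := by simpa [Ball] using hy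
    linarith [norm_sub_le z y]
  have hwy : ‖w - y‖ ≤ 2 * h := by
    rw [hw, add_sub_cancel_left, norm_smul, Real.norm_of_nonneg h0]
    nlinarith
  have hA2 := derivSup_nonneg (j + 2) u
  have key : ‖iteratedFDeriv ℝ j u w - iteratedFDeriv ℝ j u y
      - fderiv ℝ (iteratedFDeriv ℝ j u) y (w - y)‖ ≤ derivSup (j + 2) u * ‖w - y‖ * ‖w - y‖ := by
    refine Convex.norm_image_sub_le_of_norm_fderiv_le' (s := segment ℝ y w) (𝕜 := ℝ)
      (fun v _ => ?_) (fun v hv => ?_) (convex_segment _ _) (left_mem_segment _ _ _)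
      (right_mem_segment _ _ _)
    · exact hu.differentiable_iteratedFDeriv (by exact_mod_cast WithTop.coe_lt_top j) v
    · have hvB : v ∈ Ball n := (convex_closedBall _ _).segment_subset hy hwB hv
      have hvy : ‖v - y‖ ≤ ‖w - y‖ := norm_sub_le_of_mem_segment hv
      rw [fderiv_iteratedFDeriv]
      simp only [Function.comp_apply]
      rw [← LinearIsometryEquiv.map_sub, LinearIsometryEquiv.norm_map]
      exact (norm_iteratedFDeriv_sub_le hu (j + 1) hy hvB).trans
        (mul_le_mul_of_nonneg_left hvy hA2)
  have e1 : h * ‖fderiv ℝ (iteratedFDeriv ℝ j u) y (z - y)‖ =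
      ‖fderiv ℝ (iteratedFDeriv ℝ j u) y (w - y)‖ := by
    rw [hw, add_sub_cancel_left, map_smul, norm_smul, Real.norm_of_nonneg h0]
  rw [e1]
  have h4 := norm_iteratedFDeriv_le_derivSup hu j hwB
  have h5 := norm_iteratedFDeriv_le_derivSup hu j hy
  have h6 : ‖fderiv ℝ (iteratedFDeriv ℝ j u) y (w - y)‖ ≤
      ‖iteratedFDeriv ℝ j u w - iteratedFDeriv ℝ j u y
      - fderiv ℝ (iteratedFDeriv ℝ j u) y (w - y)‖ +
      ‖iteratedFDeriv ℝ j u w - iteratedFDeriv ℝ j u y‖ := by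
    rw [norm_sub_rev (iteratedFDeriv ℝ j u w - iteratedFDeriv ℝ j u y)]
    exact (norm_le_norm_sub_add _ _)
  have h7 := norm_sub_le (iteratedFDeriv ℝ j u w) (iteratedFDeriv ℝ j u y)
  have h8 : derivSup (j + 2) u * ‖w - y‖ * ‖w - y‖ ≤ derivSup (j + 2) u * (2 * h) * (2 * h) := by
    gcongr
  nlinarith

/-- Landau's inequality on the unit ball. -/
theorem derivSup_sq_le {u : E' n → F} (hu : ContDiff ℝ (⊤ : ℕ∞) u) (j : ℕ) :
    derivSup (j + 1) u ^ 2 ≤ 512 * derivSup j u * (derivSup j u + derivSup (j + 2) u) := by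
  set A0 := derivSup j u with hA0
  set A1 := derivSup (j + 1) u with hA1
  set A2 := derivSup (j + 2) u with hA2
  have p0 : 0 ≤ A0 := derivSup_nonneg _ _
  have p1 : 0 ≤ A1 := derivSup_nonneg _ _
  have p2 : 0 ≤ A2 := derivSup_nonneg _ _
  have key : ∀ h : ℝ, 0 < h → h ≤ 1 → A1 * h ≤ 4 * A0 + 8 * A2 * h ^ 2 := by
    intro h h0 h1
    rw [← le_div_iff₀ h0]
    have pos : 0 ≤ (4 * A0 + 8 * A2 * h ^ 2) / h := by positivity
    refine Real.biSup_le pos fun y hy => ?_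
    rw [← norm_fderiv_iteratedFDeriv]
    refine ContinuousLinearMap.opNorm_le_of_unit_norm pos fun e he => ?_
    have heB : e ∈ Ball n := by simp [Ball, he]
    have k1 := norm_fderiv_apply_sub_le hu j hy heB h0.le h1
    have k2 := norm_fderiv_apply_sub_le hu j hy (zero_mem_Ball n) h0.le h1
    rw [le_div_iff₀ h0]
    have k3 : fderiv ℝ (iteratedFDeriv ℝ j u) y e =
        fderiv ℝ (iteratedFDeriv ℝ j u) y (e - y) - fderiv ℝ (iteratedFDeriv ℝ j u) y (0 - y) := by
      rw [← map_sub]; simp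
    have k4 := norm_sub_le (fderiv ℝ (iteratedFDeriv ℝ j u) y (e - y))
      (fderiv ℝ (iteratedFDeriv ℝ j u) y (0 - y))
    rw [k3]
    nlinarith
  rcases p1.eq_or_lt with h | h
  · rw [← h, zero_pow two_ne_zero]
    positivity
  · have k1 := key 1 one_pos le_rfl
    set D := 2 * A0 + A2 with hD
    have hDpos : 0 < D := by nlinarith
    have k2 := key (A1 / (16 * D)) (by positivity) (by
      rw [div_le_one (by positivity)]; nlinarith)
    have k3 : A1 * (A1 / (16 * D)) * (16 * D) = A1 ^ 2 := by field_simp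
    have k4 : 8 * A2 * (A1 / (16 * D)) ^ 2 ≤ A1 ^ 2 / (32 * D) := by
      have : 8 * A2 * (A1 / (16 * D)) ^ 2 = (A2 / D) * (A1 ^ 2 / (32 * D)) := by field_simp; ring
      rw [this]
      have h5 : A2 / D ≤ 1 := by rw [div_le_one hDpos]; linarith
      exact mul_le_of_le_one_left (by positivity) h5
    have k5 : A1 ^ 2 / (32 * D) * (32 * D) = A1 ^ 2 := by field_simp
    have k6 : A1 * (A1 / (16 * D)) = 2 * (A1 ^ 2 / (32 * D)) := by field_simp; ring
    have k7 : A1 ^ 2 / (32 * D) ≤ 4 * A0 := by linarith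
    have k8 : A1 ^ 2 / (32 * D) * (32 * D) ≤ 4 * A0 * (32 * D) :=
      mul_le_mul_of_nonneg_right k7 (by positivity)
    nlinarith [mul_nonneg p0 p2, mul_nonneg p0 p0]

theorem ckNorm_sq_le {u : E' n → F} (hu : ContDiff ℝ (⊤ : ℕ∞) u) (k : ℕ) :
    ckNorm (k + 1) u ^ 2 ≤ 1026 * (ckNorm k u * ckNorm (k + 2) u) := by
  have h1 := derivSup_sq_le hu k
  have h2 : ckNorm (k + 2) u = ckNorm k u + derivSup (k + 1) u + derivSup (k + 2) u := by
    rw [ckNorm_succ, ckNorm_succ]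
  have h3 := derivSup_le_ckNorm le_rfl (k := k) u
  have p0 := derivSup_nonneg k u
  have p1 := derivSup_nonneg (k + 1) u
  have p2 := derivSup_nonneg (k + 2) u
  have p3 := ckNorm_nonneg k u
  have h4 : derivSup k u * (derivSup k u + derivSup (k + 2) u) ≤
      ckNorm k u * ckNorm (k + 2) u := by
    gcongr
    linarith
  have h5 : ckNorm k u * ckNorm k u ≤ ckNorm k u * ckNorm (k + 2) u := by
    gcongr
    linarith
  rw [ckNorm_succ]
  nlinarith [sq_nonneg (ckNorm k u - derivSup (k + 1) u)]

end SupNorms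

section Mdd

/-- The quantity whose supremum in time is `Mdd`. -/
def mSlice (x : ℝ → E' n → E' n) (s : ℕ) (t : ℝ) : ℝ :=
  ckNorm (3 + s) (x t) + ckNorm (2 + s) (Dt x t) + ckNorm (1 + s) (Dts 2 x t)

theorem SmoothST.Dts_two {u : ℝ → E' n → F} (hu : SmoothST u) : SmoothST (Dts 2 u) := hu.Dt.Dt

theorem mSlice_nonneg (x : ℝ → E' n → E' n) (s : ℕ) (t : ℝ) : 0 ≤ mSlice x s t :=
  add_nonneg (add_nonneg (ckNorm_nonneg _ _) (ckNorm_nonneg _ _)) (ckNorm_nonneg _ _)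

theorem SmoothST.exists_ckNorm_le {u : ℝ → E' n → F} (hu : SmoothST u) (T : ℝ) (k : ℕ) :
    ∃ C, ∀ t ∈ Icc 0 T, ckNorm k (u t) ≤ C := by
  have h : ∀ j, ∃ C, 0 ≤ C ∧ ∀ t ∈ Icc 0 T, derivSup j (u t) ≤ C := by
    intro j
    obtain ⟨C, hC⟩ := (isCompact_Icc.prod (isCompact_Ball n)).exists_bound_of_continuousOn
      (s := Icc 0 T ×ˢ Ball n) (hu.continuous_norm_iteratedFDeriv j).continuousOn
    refine ⟨max C 0, le_max_right _ _, fun t ht => Real.biSup_le (le_max_right _ _) fun y hy => ?_⟩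
    have := hC (t, y) ⟨ht, hy⟩
    rw [norm_norm] at this
    exact this.trans (le_max_left _ _)
  choose C _ hC using h
  exact ⟨∑ j ∈ Finset.range (k + 1), C j, fun t ht => Finset.sum_le_sum fun j _ => hC j t ht⟩

variable {x : ℝ → E' n → E' n} {T : ℝ}

theorem mSlice_le_Mdd (hx : SmoothST x) (s : ℕ) {t : ℝ} (ht : t ∈ Icc 0 T) :
    mSlice x s t ≤ Mdd T x s := by
  obtain ⟨C₁, h₁⟩ := hx.exists_ckNorm_le T (3 + s)
  obtain ⟨C₂, h₂⟩ := hx.Dt.exists_ckNorm_le T (2 + s)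
  obtain ⟨C₃, h₃⟩ := hx.Dts_two.exists_ckNorm_le T (1 + s)
  exact le_biSup_of_le (C := C₁ + C₂ + C₃) (fun t _ => mSlice_nonneg x s t)
    (fun t ht => add_le_add (add_le_add (h₁ t ht) (h₂ t ht)) (h₃ t ht)) ht

theorem Mdd_nonneg (T : ℝ) (x : ℝ → E' n → E' n) (s : ℕ) : 0 ≤ Mdd T x s :=
  Real.biSup_nonneg fun t _ => mSlice_nonneg x s t

theorem Mdd_mono (hx : SmoothST x) {s s' : ℕ} (h : s ≤ s') : Mdd T x s ≤ Mdd T x s' := by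
  refine Real.biSup_le (Mdd_nonneg _ _ _) fun t ht => le_trans ?_ (mSlice_le_Mdd hx s' ht)
  exact add_le_add (add_le_add (ckNorm_mono (by omega) _) (ckNorm_mono (by omega) _))
    (ckNorm_mono (by omega) _)

theorem Mdd_sq_le (hx : SmoothST x) (s : ℕ) :
    Mdd T x (s + 1) ^ 2 ≤ 3078 * (Mdd T x s * Mdd T x (s + 2)) := by
  have hnn : 0 ≤ 3078 * (Mdd T x s * Mdd T x (s + 2)) :=
    mul_nonneg (by norm_num) (mul_nonneg (Mdd_nonneg _ _ _) (Mdd_nonneg _ _ _))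
  rw [← Real.le_sqrt (Mdd_nonneg _ _ _) hnn]
  refine Real.biSup_le (Real.sqrt_nonneg _) fun t ht => Real.le_sqrt_of_sq_le ?_
  have h1 := ckNorm_sq_le (hx.contDiff_slice t) (3 + s)
  have h2 := ckNorm_sq_le (hx.Dt.contDiff_slice t) (2 + s)
  have h3 := ckNorm_sq_le (hx.Dts_two.contDiff_slice t) (1 + s)
  have m1 := mSlice_le_Mdd hx s ht
  have m2 := mSlice_le_Mdd hx (s + 2) ht
  have h4 : mSlice x s t * mSlice x (s + 2) t ≤ Mdd T x s * Mdd T x (s + 2) :=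
    mul_le_mul m1 m2 (mSlice_nonneg _ _ _) (Mdd_nonneg _ _ _)
  refine le_trans ?_ (mul_le_mul_of_nonneg_left h4 (by norm_num))
  unfold mSlice
  simp only [← add_assoc] at *
  set a0 := ckNorm (3 + s) (x t)
  set a1 := ckNorm (3 + s + 1) (x t)
  set a2 := ckNorm (3 + s + 2) (x t)
  set b0 := ckNorm (2 + s) (Dt x t)
  set b1 := ckNorm (2 + s + 1) (Dt x t)
  set b2 := ckNorm (2 + s + 2) (Dt x t)
  set c0 := ckNorm (1 + s) (Dts 2 x t)
  set c1 := ckNorm (1 + s + 1) (Dts 2 x t)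
  set c2 := ckNorm (1 + s + 2) (Dts 2 x t)
  have pa0 : 0 ≤ a0 := ckNorm_nonneg _ _
  have pa2 : 0 ≤ a2 := ckNorm_nonneg _ _
  have pb0 : 0 ≤ b0 := ckNorm_nonneg _ _
  have pb2 : 0 ≤ b2 := ckNorm_nonneg _ _
  have pc0 : 0 ≤ c0 := ckNorm_nonneg _ _
  have pc2 : 0 ≤ c2 := ckNorm_nonneg _ _
  have q : (a1 + b1 + c1) ^ 2 ≤ 3 * (a1 ^ 2 + b1 ^ 2 + c1 ^ 2) := by
    nlinarith [sq_nonneg (a1 - b1), sq_nonneg (a1 - c1), sq_nonneg (b1 - c1)]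
  have q2 : a0 * a2 + b0 * b2 + c0 * c2 ≤ (a0 + b0 + c0) * (a2 + b2 + c2) := by
    nlinarith [mul_nonneg pa0 pb2, mul_nonneg pa0 pc2, mul_nonneg pb0 pa2, mul_nonneg pb0 pc2,
      mul_nonneg pc0 pa2, mul_nonneg pc0 pb2]
  linarith

theorem Mdd_mul_succ_le (hx : SmoothST x) (hpos : ∀ s, 0 < Mdd T x s) (i j : ℕ) :
    Mdd T x (i + 1) * Mdd T x (i + j) ≤ 3078 ^ j * (Mdd T x i * Mdd T x (i + j + 1)) := by
  induction j with
  | zero => simp [mul_comm]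
  | succ j ih =>
    have h := Mdd_sq_le (T := T) hx (i + j)
    have p := hpos (i + j + 1)
    have p0 := hpos (i + j)
    refine le_of_mul_le_mul_right ?_ p0
    have e1 : i + (j + 1) = i + j + 1 := rfl
    have e2 : i + j + 1 + 1 = i + j + 2 := rfl
    rw [e1, e2]
    calc Mdd T x (i + 1) * Mdd T x (i + j + 1) * Mdd T x (i + j)
        = Mdd T x (i + 1) * Mdd T x (i + j) * Mdd T x (i + j + 1) := by ring
      _ ≤ 3078 ^ j * (Mdd T x i * Mdd T x (i + j + 1)) * Mdd T x (i + j + 1) := by gcongr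
      _ = 3078 ^ j * Mdd T x i * Mdd T x (i + j + 1) ^ 2 := by ring
      _ ≤ 3078 ^ j * Mdd T x i * (3078 * (Mdd T x (i + j) * Mdd T x (i + j + 2))) := by
          gcongr
          exact mul_nonneg (by positivity) (hpos i).le
      _ = _ := by ring

/-- Interpolation inequality for the quantities `Mdd`. -/
theorem Mdd_mul_le (hx : SmoothST x) (hpos : ∀ s, 0 < Mdd T x s) (i j : ℕ) :
    Mdd T x i * Mdd T x j ≤ 3078 ^ (i * j) * (Mdd T x 0 * Mdd T x (i + j)) := by
  induction i with
  | zero => simp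
  | succ i ih =>
    have h := Mdd_mul_succ_le hx hpos i j
    have p0 := hpos (i + j)
    refine le_of_mul_le_mul_right ?_ p0
    have e : i + 1 + j = i + j + 1 := by omega
    rw [e]
    have p1 := hpos (i + j + 1)
    have p2 := hpos j
    calc Mdd T x (i + 1) * Mdd T x j * Mdd T x (i + j)
        = Mdd T x (i + 1) * Mdd T x (i + j) * Mdd T x j := by ring
      _ ≤ 3078 ^ j * (Mdd T x i * Mdd T x (i + j + 1)) * Mdd T x j := by gcongr
      _ = 3078 ^ j * Mdd T x (i + j + 1) * (Mdd T x i * Mdd T x j) := by ring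
      _ ≤ 3078 ^ j * Mdd T x (i + j + 1) * (3078 ^ (i * j) * (Mdd T x 0 * Mdd T x (i + j))) := by
          gcongr
      _ = _ := by ring

end Mdd

section Tame

variable {ι : Type*}

/-- Weight sequences, uniformly submultiplicative and uniformly bounded below at order zero. -/
structure TameWeight (A : ι → ℕ → ℝ) : Prop where
  nonneg : ∀ i k, 0 ≤ A i k
  lower : ∃ c > 0, ∀ i, c ≤ A i 0
  mul_le : ∀ a b, ∃ D, 0 ≤ D ∧ ∀ i, A i a * A i b ≤ D * A i (a + b)

/-- Derivatives of order `k` are controlled by the weight of order `k + p`. -/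
def TameAt (A : ι → ℕ → ℝ) (p k : ℕ) (u : ι → E' n → F) : Prop :=
  ∃ C, 0 ≤ C ∧ ∀ i, ∀ y ∈ Metric.ball (0 : E' n) 1, ‖iteratedFDeriv ℝ k (u i) y‖ ≤ C * A i (k + p)

/-- Smooth families in the unit ball whose derivatives are controlled by the weights. -/
structure Tame (A : ι → ℕ → ℝ) (u : ι → E' n → F) : Prop where
  smooth : ∀ i, ContDiffOn ℝ (⊤ : ℕ∞) (u i) (Metric.ball 0 1)
  bound : ∀ k, TameAt A 0 k u

variable {A : ι → ℕ → ℝ}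

theorem TameAt.smul (hA : TameWeight A) {p k : ℕ} {u : ι → E' n → ℝ} {v : ι → E' n → F}
    (hu : ∀ i, ContDiffOn ℝ (⊤ : ℕ∞) (u i) (Metric.ball 0 1))
    (hv : ∀ i, ContDiffOn ℝ (⊤ : ℕ∞) (v i) (Metric.ball 0 1))
    (hu' : ∀ a ≤ k, TameAt A 0 a u) (hv' : ∀ a ≤ k, TameAt A p a v) :
    TameAt A p k (fun i y => u i y • v i y) := by
  have h : ∀ a, ∃ C, 0 ≤ C ∧ (a ≤ k → ∀ i, ∀ y ∈ Metric.ball (0 : E' n) 1,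
      ‖iteratedFDeriv ℝ a (u i) y‖ * ‖iteratedFDeriv ℝ (k - a) (v i) y‖ ≤ C * A i (k + p)) := by
    intro a
    by_cases ha : a ≤ k
    · obtain ⟨C₁, hC₁, h₁⟩ := hu' a ha
      obtain ⟨C₂, hC₂, h₂⟩ := hv' (k - a) (Nat.sub_le _ _)
      obtain ⟨D, hD, h₃⟩ := hA.mul_le a (k - a + p)
      refine ⟨C₁ * C₂ * D, by positivity, fun _ i y hy => ?_⟩
      have h₄ := h₃ i
      rw [show a + (k - a + p) = k + p by omega] at h₄
      calc _ ≤ (C₁ * A i (a + 0)) * (C₂ * A i (k - a + p)) :=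
            mul_le_mul (h₁ i y hy) (h₂ i y hy) (norm_nonneg _) (mul_nonneg hC₁ (hA.nonneg _ _))
        _ = C₁ * C₂ * (A i a * A i (k - a + p)) := by rw [add_zero]; ring
        _ ≤ C₁ * C₂ * (D * A i (k + p)) := by gcongr
        _ = _ := by ring
    · exact ⟨0, le_rfl, fun h => absurd h ha⟩
  choose C hC hC' using h
  refine ⟨∑ a ∈ Finset.range (k + 1), (k.choose a : ℝ) * C a,
    Finset.sum_nonneg fun a _ => mul_nonneg (Nat.cast_nonneg _) (hC a), fun i y hy => ?_⟩
  have h := norm_iteratedFDerivWithin_smul_le (hu i) (hv i) Metric.isOpen_ball.uniqueDiffOn hy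
    (n := k) (by exact_mod_cast le_top)
  simp only [iteratedFDerivWithin_of_isOpen _ Metric.isOpen_ball hy] at h
  refine h.trans ?_
  rw [Finset.sum_mul]
  refine Finset.sum_le_sum fun a ha => ?_
  rw [mul_assoc, mul_assoc]
  exact mul_le_mul_of_nonneg_left (hC' a (by simpa [Nat.lt_succ_iff] using ha) i y hy)
    (Nat.cast_nonneg _)

theorem Tame.smul (hA : TameWeight A) {u : ι → E' n → ℝ} {v : ι → E' n → F}
    (hu : Tame A u) (hv : Tame A v) : Tame A (fun i y => u i y • v i y) :=
  ⟨fun i => (hu.smooth i).smul (hv.smooth i), fun _ =>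
    TameAt.smul hA hu.smooth hv.smooth (fun a _ => hu.bound a) (fun a _ => hv.bound a)⟩

theorem Tame.mul (hA : TameWeight A) {u v : ι → E' n → ℝ}
    (hu : Tame A u) (hv : Tame A v) : Tame A (fun i y => u i y * v i y) :=
  Tame.smul hA hu hv

theorem Tame.add {u v : ι → E' n → F}
    (hu : Tame A u) (hv : Tame A v) : Tame A (fun i y => u i y + v i y) := by
  refine ⟨fun i => (hu.smooth i).add (hv.smooth i), fun k => ?_⟩
  obtain ⟨C₁, hC₁, h₁⟩ := hu.bound k
  obtain ⟨C₂, hC₂, h₂⟩ := hv.bound k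
  refine ⟨C₁ + C₂, add_nonneg hC₁ hC₂, fun i y hy => ?_⟩
  have e := iteratedFDeriv_add_apply (𝕜 := ℝ) (i := k)
    (((hu.smooth i).contDiffAt (Metric.isOpen_ball.mem_nhds hy)).of_le (by exact_mod_cast le_top))
    (((hv.smooth i).contDiffAt (Metric.isOpen_ball.mem_nhds hy)).of_le (by exact_mod_cast le_top))
  change ‖iteratedFDeriv ℝ k (u i + v i) y‖ ≤ _
  rw [e, add_mul]
  exact (norm_add_le _ _).trans (add_le_add (h₁ i y hy) (h₂ i y hy))

theorem Tame.const (hA : TameWeight A) (c : F) : Tame A (fun (_ : ι) (_ : E' n) => c) := by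
  refine ⟨fun i => contDiffOn_const, fun k => ?_⟩
  obtain ⟨d, hd, h⟩ := hA.lower
  cases k with
  | zero =>
    refine ⟨‖c‖ / d, by positivity, fun i y _ => ?_⟩
    rw [norm_iteratedFDeriv_zero, div_mul_eq_mul_div, le_div_iff₀ hd]
    exact mul_le_mul_of_nonneg_left (h i) (norm_nonneg _)
  | succ k =>
    refine ⟨0, le_rfl, fun i y _ => ?_⟩
    simp [iteratedFDeriv_const_of_ne]

theorem Tame.neg (hA : TameWeight A) {u : ι → E' n → F} (hu : Tame A u) :
    Tame A (fun i y => - u i y) := by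
  simpa using Tame.smul hA (Tame.const hA (-1 : ℝ)) hu

theorem Tame.inv (hA : TameWeight A) {q : ι → E' n → ℝ} (hq : Tame A q) {c : ℝ} (hc : 0 < c)
    (hqc : ∀ i, ∀ y ∈ Metric.ball (0 : E' n) 1, c ≤ |q i y|) : Tame A (fun i y => (q i y)⁻¹) := by
  have hne : ∀ i, ∀ y ∈ Metric.ball (0 : E' n) 1, q i y ≠ 0 := fun i y hy h => by
    have := hqc i y hy
    rw [h, abs_zero] at this
    linarith
  have hs : ∀ i, ContDiffOn ℝ (⊤ : ℕ∞) (fun y => (q i y)⁻¹) (Metric.ball 0 1) :=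
    fun i => (hq.smooth i).inv (hne i)
  refine ⟨hs, fun k => ?_⟩
  induction k using Nat.strong_induction_on with
  | _ k ih =>
  cases k with
  | zero =>
    obtain ⟨d, hd, h⟩ := hA.lower
    refine ⟨c⁻¹ / d, by positivity, fun i y hy => ?_⟩
    rw [norm_iteratedFDeriv_zero, div_mul_eq_mul_div, le_div_iff₀ hd, norm_inv]
    have h1 : ‖q i y‖⁻¹ ≤ c⁻¹ := inv_anti₀ hc (hqc i y hy)
    exact mul_le_mul h1 (h i) hd.le (by positivity)
  | succ k =>
    have hnq := hq.neg hA
    have hds : ∀ i, ContDiffOn ℝ (⊤ : ℕ∞) (fderiv ℝ (fun y => - q i y)) (Metric.ball 0 1) :=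
      fun i => (hnq.smooth i).fderiv_of_isOpen Metric.isOpen_ball (by simp)
    have hd : ∀ a ≤ k, TameAt A 1 a (fun i => fderiv ℝ (fun y => - q i y)) := by
      intro a _
      obtain ⟨C, hC, h⟩ := hnq.bound (a + 1)
      refine ⟨C, hC, fun i y hy => ?_⟩
      rw [norm_iteratedFDeriv_fderiv]
      exact h i y hy
    have hRR : ∀ a ≤ k, TameAt A 0 a (fun i y => (q i y)⁻¹ • (q i y)⁻¹) := fun a ha =>
      TameAt.smul hA hs hs (fun b hb => ih b (by omega)) (fun b hb => ih b (by omega))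
    obtain ⟨C, hC, h⟩ := TameAt.smul hA (fun i => (hs i).smul (hs i)) hds hRR hd
    refine ⟨C, hC, fun i y hy => ?_⟩
    rw [← norm_iteratedFDeriv_fderiv]
    have e : fderiv ℝ (fun y => (q i y)⁻¹) =ᶠ[nhds y]
        fun y => ((q i y)⁻¹ • (q i y)⁻¹) • fderiv ℝ (fun y => - q i y) y := by
      filter_upwards [Metric.isOpen_ball.mem_nhds hy] with z hz
      have hdz : HasFDerivAt (q i) (fderiv ℝ (q i) z) z :=
        (((hq.smooth i).contDiffAt (Metric.isOpen_ball.mem_nhds hz)).differentiableAt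
          (by simp)).hasFDerivAt
      have h1 := (hasDerivAt_inv (hne i z hz)).comp_hasFDerivAt z hdz
      have h2 : HasFDerivAt (fun y => (q i y)⁻¹) (-((q i z) ^ 2)⁻¹ • fderiv ℝ (q i) z) z := h1
      rw [h2.fderiv, hdz.fun_neg.fderiv]
      rw [smul_neg, neg_smul, smul_eq_mul, ← mul_inv, pow_two]
    rw [(e.iteratedFDeriv ℝ k).eq_of_nhds]
    exact h i y hy

/-- Space-time families whose time derivatives up to second order are tame at the times `τ`. -/
structure Tame₂ (A : ι → ℕ → ℝ) (τ : ι → ℝ) (u : ι → ℝ → E' n → ℝ) : Prop where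
  smooth : ∀ i, SmoothST (u i)
  tame : Tame A (fun i => u i (τ i))
  tame_Dt : Tame A (fun i => Dt (u i) (τ i))
  tame_Dt₂ : Tame A (fun i => Dt (Dt (u i)) (τ i))

theorem SmoothST.mul {u v : ℝ → E' n → ℝ} (hu : SmoothST u) (hv : SmoothST v) :
    SmoothST (fun t y => u t y * v t y) := ContDiff.mul hu hv

theorem SmoothST.add {u v : ℝ → E' n → F} (hu : SmoothST u) (hv : SmoothST v) :
    SmoothST (fun t y => u t y + v t y) := ContDiff.add hu hv

theorem SmoothST.Dt_mul {u v : ℝ → E' n → ℝ} (hu : SmoothST u) (hv : SmoothST v) :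
    _root_.Dt (fun t y => u t y * v t y) =
      fun t y => _root_.Dt u t y * v t y + u t y * _root_.Dt v t y := by
  funext t y
  exact ((hu.hasDerivAt t y).mul (hv.hasDerivAt t y)).deriv

theorem SmoothST.Dt_add {u v : ℝ → E' n → F} (hu : SmoothST u) (hv : SmoothST v) :
    _root_.Dt (fun t y => u t y + v t y) =
      fun t y => _root_.Dt u t y + _root_.Dt v t y := by
  funext t y
  exact ((hu.hasDerivAt t y).add (hv.hasDerivAt t y)).deriv

variable {τ : ι → ℝ}

theorem Tame₂.mul (hA : TameWeight A) {u v : ι → ℝ → E' n → ℝ} (hu : Tame₂ A τ u)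
    (hv : Tame₂ A τ v) : Tame₂ A τ (fun i t y => u i t y * v i t y) := by
  have e1 : ∀ i, Dt (fun t y => u i t y * v i t y) =
      fun t y => Dt (u i) t y * v i t y + u i t y * Dt (v i) t y :=
    fun i => (hu.smooth i).Dt_mul (hv.smooth i)
  have e2 : ∀ i, Dt (Dt (fun t y => u i t y * v i t y)) =
      fun t y => (Dt (Dt (u i)) t y * v i t y + Dt (u i) t y * Dt (v i) t y) +
        (Dt (u i) t y * Dt (v i) t y + u i t y * Dt (Dt (v i)) t y) := by
    intro i
    rw [e1, ((hu.smooth i).Dt.mul (hv.smooth i)).Dt_add ((hu.smooth i).mul (hv.smooth i).Dt),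
      (hu.smooth i).Dt.Dt_mul (hv.smooth i), (hu.smooth i).Dt_mul (hv.smooth i).Dt]
  refine ⟨fun i => (hu.smooth i).mul (hv.smooth i), hu.tame.mul hA hv.tame, ?_, ?_⟩
  · simp only [e1]
    exact (hu.tame_Dt.mul hA hv.tame).add (hu.tame.mul hA hv.tame_Dt)
  · simp only [e2]
    exact ((hu.tame_Dt₂.mul hA hv.tame).add (hu.tame_Dt.mul hA hv.tame_Dt)).add
      ((hu.tame_Dt.mul hA hv.tame_Dt).add (hu.tame.mul hA hv.tame_Dt₂))

theorem Tame₂.add {u v : ι → ℝ → E' n → ℝ} (hu : Tame₂ A τ u)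
    (hv : Tame₂ A τ v) : Tame₂ A τ (fun i t y => u i t y + v i t y) := by
  have e1 : ∀ i, Dt (fun t y => u i t y + v i t y) = fun t y => Dt (u i) t y + Dt (v i) t y :=
    fun i => (hu.smooth i).Dt_add (hv.smooth i)
  refine ⟨fun i => (hu.smooth i).add (hv.smooth i), hu.tame.add hv.tame, ?_, ?_⟩
  · simp only [e1]
    exact hu.tame_Dt.add hv.tame_Dt
  · simp only [e1, (hu.smooth _).Dt.Dt_add (hv.smooth _).Dt]
    exact hu.tame_Dt₂.add hv.tame_Dt₂

theorem Tame₂.const (hA : TameWeight A) (c : ℝ) :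
    Tame₂ A τ (fun (_ : ι) (_ : ℝ) (_ : E' n) => c) := by
  have e1 : ∀ d : ℝ, Dt (fun (_ : ℝ) (_ : E' n) => d) = fun _ _ => 0 := fun d => by
    funext t y
    exact deriv_const t d
  refine ⟨fun i => contDiff_const, Tame.const hA c, ?_, ?_⟩
  · simp only [e1]
    exact Tame.const hA 0
  · simp only [e1]
    exact Tame.const hA 0

theorem Tame₂.prod (hA : TameWeight A) {J : Type*} (s : Finset J) {u : J → ι → ℝ → E' n → ℝ}
    (hu : ∀ j, Tame₂ A τ (u j)) : Tame₂ A τ (fun i t y => ∏ j ∈ s, u j i t y) := by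
  classical
  induction s using Finset.induction_on with
  | empty => simpa using Tame₂.const hA 1
  | insert j s hj ih =>
    simp only [Finset.prod_insert hj]
    exact (hu j).mul hA ih

theorem Tame₂.sum (hA : TameWeight A) {J : Type*} (s : Finset J) {u : J → ι → ℝ → E' n → ℝ}
    (hu : ∀ j, Tame₂ A τ (u j)) : Tame₂ A τ (fun i t y => ∑ j ∈ s, u j i t y) := by
  classical
  induction s using Finset.induction_on with
  | empty => simpa using Tame₂.const hA 0
  | insert j s hj ih =>
    simp only [Finset.sum_insert hj]
    exact (hu j).add ih

theorem Tame₂.det (hA : TameWeight A) {J : Type*} [Fintype J] [DecidableEq J]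
    {M : ι → ℝ → E' n → Matrix J J ℝ} (hM : ∀ a b, Tame₂ A τ (fun i t y => M i t y a b)) :
    Tame₂ A τ (fun i t y => (M i t y).det) := by
  simp only [Matrix.det_apply']
  exact Tame₂.sum hA _ fun σ => (Tame₂.const hA _).mul hA (Tame₂.prod hA _ fun j => hM _ _)

theorem Dts_two_log {u : ℝ → E' n → ℝ} (hu : SmoothST u) {t : ℝ} {y : E' n} (h : u t y ≠ 0) :
    Dts 2 (fun s z => Real.log (u s z)) t y =
      Dt (Dt u) t y * (u t y)⁻¹ + -(Dt u t y * (u t y)⁻¹ * (Dt u t y * (u t y)⁻¹)) := by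
  have hc : ContinuousAt (fun s => u s y) t := (hu.hasDerivAt t y).continuousAt
  have e : (fun s => Dt (fun s z => Real.log (u s z)) s y) =ᶠ[nhds t]
      fun s => Dt u s y * (u s y)⁻¹ := by
    filter_upwards [hc.eventually_ne h] with s hs
    exact ((hu.hasDerivAt s y).log hs).deriv
  change deriv (fun s => Dt (fun s z => Real.log (u s z)) s y) t = _
  rw [e.deriv_eq, ((hu.Dt.hasDerivAt t y).fun_mul ((hu.hasDerivAt t y).fun_inv h)).deriv]
  field_simp

theorem Tame₂.tame_log (hA : TameWeight A) {u : ι → ℝ → E' n → ℝ} (hu : Tame₂ A τ u) {c : ℝ}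
    (hc : 0 < c) (huc : ∀ i, ∀ y ∈ Metric.ball (0 : E' n) 1, c ≤ |u i (τ i) y|) :
    Tame A (fun i => Dts 2 (fun s z => Real.log (u i s z)) (τ i)) := by
  have hR := hu.tame.inv hA hc huc
  have hDR := hu.tame_Dt.mul hA hR
  have key := (hu.tame_Dt₂.mul hA hR).add ((hDR.mul hA hDR).neg hA)
  have e : ∀ i, ∀ y ∈ Metric.ball (0 : E' n) 1, Dts 2 (fun s z => Real.log (u i s z)) (τ i) y = _ :=
    fun i y hy => Dts_two_log (hu.smooth i) (t := τ i) (y := y) fun h => by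
      have := huc i y hy
      rw [h, abs_zero] at this
      linarith
  refine ⟨fun i => (key.smooth i).congr (e i), fun k => ?_⟩
  obtain ⟨C, hC, h⟩ := key.bound k
  refine ⟨C, hC, fun i y hy => ?_⟩
  have e' := Filter.eventuallyEq_of_mem (Metric.isOpen_ball.mem_nhds hy) (e i)
  rw [(e'.iteratedFDeriv ℝ k).eq_of_nhds]
  exact h i y hy

end Tame

section Geometry

/-- Entry `(i, a)` of a linear endomorphism of `ℝⁿ`. -/
def entryCLM (i a : Fin n) : (E' n →L[ℝ] E' n) →L[ℝ] ℝ :=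
  (EuclideanSpace.proj i : E' n →L[ℝ] ℝ).comp
    (ContinuousLinearMap.apply ℝ (E' n) (EuclideanSpace.single a (1 : ℝ)))

theorem entryCLM_apply (i a : Fin n) (L : E' n →L[ℝ] E' n) :
    entryCLM i a L = L (EuclideanSpace.single a (1 : ℝ)) i := rfl

theorem norm_entryCLM_le (i a : Fin n) : ‖entryCLM (n := n) i a‖ ≤ 1 := by
  refine ContinuousLinearMap.opNorm_le_bound _ zero_le_one fun L => ?_
  rw [entryCLM_apply, one_mul]
  refine (PiLp.norm_apply_le _ i).trans ?_
  simpa using L.le_opNorm (EuclideanSpace.single a (1 : ℝ))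

theorem jacM_apply {u : E' n → E' n} (hu : ContDiff ℝ (⊤ : ℕ∞) u) (y : E' n) (i a : Fin n) :
    jacM u y i a = entryCLM i a (fderiv ℝ u y) := by
  have h := (EuclideanSpace.proj i : E' n →L[ℝ] ℝ).hasFDerivAt.comp y
    (hu.differentiable (by simp) y).hasFDerivAt
  change fderiv ℝ (fun z => u z i) y (EuclideanSpace.single a 1) = _
  have h' : HasFDerivAt (fun z => u z i)
    ((EuclideanSpace.proj i : E' n →L[ℝ] ℝ).comp (fderiv ℝ u y)) y := h
  rw [h'.fderiv]
  rfl

theorem abs_jacM_apply_le {u : E' n → E' n} (hu : ContDiff ℝ (⊤ : ℕ∞) u) (y : E' n)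
    (i a : Fin n) : |jacM u y i a| ≤ ‖iteratedFDeriv ℝ 1 u y‖ := by
  rw [jacM_apply hu, ← Real.norm_eq_abs]
  refine ((entryCLM i a).le_opNorm _).trans ?_
  have h : ‖fderiv ℝ u y‖ = ‖iteratedFDeriv ℝ 1 u y‖ := by
    rw [← zero_add 1, ← norm_iteratedFDeriv_fderiv, norm_iteratedFDeriv_zero]
  rw [h]
  exact mul_le_of_le_one_left (norm_nonneg _) (norm_entryCLM_le i a)

theorem norm_iteratedFDeriv_entryCLM_le {u : E' n → E' n} (hu : ContDiff ℝ (⊤ : ℕ∞) u)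
    (i a : Fin n) (k : ℕ) (y : E' n) :
    ‖iteratedFDeriv ℝ k (fun z => entryCLM i a (fderiv ℝ u z)) y‖ ≤
      ‖iteratedFDeriv ℝ (k + 1) u y‖ := by
  have h := (entryCLM i a).norm_iteratedFDeriv_comp_left (f := fderiv ℝ u) (x := y) (n := k)
    (N := (⊤ : ℕ∞)) (hu.fderiv_right (by simp)).contDiffAt (by exact_mod_cast le_top)
  rw [norm_iteratedFDeriv_fderiv] at h
  exact h.trans (mul_le_of_le_one_left (norm_nonneg _) (norm_entryCLM_le i a))

theorem abs_inv_jacM_apply_le {u : E' n → E' n} {y : E' n} {c₁ : ℝ} (h : coordCond u c₁ y)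
    (i a : Fin n) : |(jacM u y)⁻¹ i a| ≤ |c₁| := by
  rw [← sq_le_sq]
  refine le_trans ?_ h
  have h1 : (jacM u y)⁻¹ i a ^ 2 ≤ ∑ a, (jacM u y)⁻¹ i a ^ 2 :=
    Finset.single_le_sum (f := fun a => (jacM u y)⁻¹ i a ^ 2) (fun _ _ => sq_nonneg _)
      (Finset.mem_univ a)
  have h2 : ∑ a, (jacM u y)⁻¹ i a ^ 2 ≤ ∑ i, ∑ a, (jacM u y)⁻¹ i a ^ 2 :=
    Finset.single_le_sum (f := fun i => ∑ a, (jacM u y)⁻¹ i a ^ 2)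
      (fun _ _ => Finset.sum_nonneg fun _ _ => sq_nonneg _) (Finset.mem_univ i)
  have h3 : 0 ≤ ∑ i, ∑ a, (jacM u y i a) ^ 2 :=
    Finset.sum_nonneg fun _ _ => Finset.sum_nonneg fun _ _ => sq_nonneg _
  linarith

theorem le_abs_kappa {u : E' n → E' n} {y : E' n} {c₁ : ℝ} (h : coordCond u c₁ y)
    (hdet : (jacM u y).det ≠ 0) : (n.factorial * |c₁| ^ n + 1)⁻¹ ≤ |kappa u y| := by
  have h1 := Matrix.det_le (A := (jacM u y)⁻¹) (abv := AbsoluteValue.abs) (x := |c₁|)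
    (fun i a => abs_inv_jacM_apply_le h i a)
  have h2 : (jacM u y)⁻¹.det * (jacM u y).det = 1 := by
    rw [← Matrix.det_mul, Matrix.nonsing_inv_mul _ (isUnit_iff_ne_zero.2 hdet), Matrix.det_one]
  have h3 : |(jacM u y)⁻¹.det| * |kappa u y| = 1 := by
    unfold kappa
    rw [← abs_mul, h2, abs_one]
  have h4 : |(jacM u y)⁻¹.det| ≤ n.factorial * |c₁| ^ n := by
    simpa using h1
  rw [inv_le_iff_one_le_mul₀' (by positivity), ← h3]
  gcongr
  linarith

/-- Coordinates satisfying the coordinate condition on `[0,T]`, with `Mdd T x 0 ≤ M`. -/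
structure Admissible (c₁ M T : ℝ) (x : ℝ → E' n → E' n) : Prop where
  pos : 0 < T
  smooth : SmoothST x
  det_ne : ∀ t ∈ Icc (0 : ℝ) T, ∀ y ∈ Ball n, (jacM (x t) y).det ≠ 0
  coord : ∀ t ∈ Icc (0 : ℝ) T, ∀ y ∈ Ball n, coordCond (x t) c₁ y
  Mdd_le : Mdd T x 0 ≤ M

variable {c₁ M T : ℝ} {x : ℝ → E' n → E' n}

theorem Admissible.le_Mdd_zero (h : Admissible c₁ M T x) (hn : 0 < n) :
    (n * |c₁| + 1)⁻¹ ≤ Mdd T x 0 := by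
  have h0 : (0 : ℝ) ∈ Icc 0 T := ⟨le_rfl, h.pos.le⟩
  have hB := zero_mem_Ball n
  set i : Fin n := ⟨0, hn⟩
  have h1 : (jacM (x 0) 0 * (jacM (x 0) 0)⁻¹) i i = 1 := by
    rw [Matrix.mul_nonsing_inv _ (isUnit_iff_ne_zero.2 (h.det_ne 0 h0 0 hB)), Matrix.one_apply_eq]
  have h2 : ∀ a, jacM (x 0) 0 i a * (jacM (x 0) 0)⁻¹ a i ≤ Mdd T x 0 * |c₁| := by
    intro a
    refine (le_abs_self _).trans ?_
    rw [abs_mul]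
    refine mul_le_mul ?_ (abs_inv_jacM_apply_le (h.coord 0 h0 0 hB) a i) (abs_nonneg _)
      (Mdd_nonneg _ _ _)
    refine (abs_jacM_apply_le (h.smooth.contDiff_slice 0) 0 i a).trans ?_
    refine (norm_iteratedFDeriv_le_derivSup (h.smooth.contDiff_slice 0) 1 hB).trans ?_
    refine (derivSup_le_ckNorm (k := 3 + 0) (by norm_num) _).trans ?_
    refine le_trans ?_ (mSlice_le_Mdd h.smooth 0 h0)
    unfold mSlice
    linarith [ckNorm_nonneg (2 + 0) (Dt x 0), ckNorm_nonneg (1 + 0) (Dts 2 x 0)]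
  have h3 : (1 : ℝ) ≤ n * (Mdd T x 0 * |c₁|) := by
    rw [← h1, Matrix.mul_apply]
    refine (Finset.sum_le_sum fun a _ => h2 a).trans ?_
    simp
  rw [inv_le_iff_one_le_mul₀' (by positivity)]
  linarith [Mdd_nonneg T x 0]

theorem Admissible.Mdd_pos (h : Admissible c₁ M T x) (hn : 0 < n) (s : ℕ) : 0 < Mdd T x s :=
  lt_of_lt_of_le (by positivity) ((h.le_Mdd_zero hn).trans (Mdd_mono h.smooth (Nat.zero_le s)))

theorem Admissible.Mdd_mul_le (h : Admissible c₁ M T x) (hn : 0 < n) (a b : ℕ) :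
    Mdd T x a * Mdd T x b ≤ 3078 ^ (a * b) * M * Mdd T x (a + b) := by
  refine (_root_.Mdd_mul_le h.smooth (h.Mdd_pos hn) a b).trans ?_
  rw [mul_assoc]
  gcongr
  · exact Mdd_nonneg _ _ _
  · exact h.Mdd_le

/-- Admissible coordinates together with a time in `[0,T]`. -/
abbrev AdmissibleIndex (n : ℕ) (c₁ M : ℝ) : Type :=
  {p : ℝ × (ℝ → E' n → E' n) × ℝ // Admissible c₁ M p.1 p.2.1 ∧ p.2.2 ∈ Icc (0 : ℝ) p.1}

theorem tameWeight_Mdd (hn : 0 < n) (c₁ M : ℝ) :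
    TameWeight (fun (p : AdmissibleIndex n c₁ M) k => Mdd p.1.1 p.1.2.1 k) where
  nonneg p k := Mdd_nonneg _ _ _
  lower := ⟨(n * |c₁| + 1)⁻¹, by positivity, fun p => p.2.1.le_Mdd_zero hn⟩
  mul_le a b := by
    refine ⟨3078 ^ (a * b) * max M 0, by positivity, fun p => ?_⟩
    refine (p.2.1.Mdd_mul_le hn a b).trans ?_
    have := Mdd_nonneg p.1.1 p.1.2.1 (a + b)
    gcongr
    exact le_max_left _ _

theorem tame_entry {v : AdmissibleIndex n c₁ M → E' n → E' n}
    (hv : ∀ p, ContDiff ℝ (⊤ : ℕ∞) (v p))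
    (h : ∀ p k, ckNorm (1 + k) (v p) ≤ Mdd p.1.1 p.1.2.1 k) (i a : Fin n) :
    Tame (fun (p : AdmissibleIndex n c₁ M) k => Mdd p.1.1 p.1.2.1 k)
      (fun p y => entryCLM i a (fderiv ℝ (v p) y)) := by
  refine ⟨fun p => ((entryCLM i a).contDiff.comp ((hv p).fderiv_right (by simp))).contDiffOn,
    fun k => ⟨1, zero_le_one, fun p y hy => ?_⟩⟩
  rw [one_mul, add_zero]
  refine (norm_iteratedFDeriv_entryCLM_le (hv p) i a k y).trans ?_
  refine (norm_iteratedFDeriv_le_derivSup (hv p) _ (Metric.ball_subset_closedBall hy)).trans ?_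
  exact (derivSup_le_ckNorm (by omega) _).trans (h p k)

theorem tame₂_jacM (i a : Fin n) :
    Tame₂ (fun (p : AdmissibleIndex n c₁ M) k => Mdd p.1.1 p.1.2.1 k) (fun p => p.1.2.2)
      (fun p t y => jacM (p.1.2.1 t) y i a) := by
  have e : (fun (p : AdmissibleIndex n c₁ M) t y => jacM (p.1.2.1 t) y i a) =
      fun p t y => entryCLM i a (fderiv ℝ (p.1.2.1 t) y) := by
    funext p t y
    exact jacM_apply (p.2.1.smooth.contDiff_slice t) y i a
  have e1 : ∀ v : ℝ → E' n → E' n, SmoothST v →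
      Dt (fun t y => entryCLM i a (fderiv ℝ (v t) y)) =
      fun t y => entryCLM i a (fderiv ℝ (Dt v t) y) := fun v hv => by
    rw [hv.fderiv.Dt_clm_comp, hv.Dt_fderiv]
  have hm : ∀ (p : AdmissibleIndex n c₁ M) k,
      mSlice p.1.2.1 k p.1.2.2 ≤ Mdd p.1.1 p.1.2.1 k := fun p k =>
    mSlice_le_Mdd p.2.1.smooth k p.2.2
  have hc1 : ∀ (p : AdmissibleIndex n c₁ M) k, 0 ≤ ckNorm (3 + k) (p.1.2.1 p.1.2.2) :=
    fun p k => ckNorm_nonneg _ _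
  have hc2 : ∀ (p : AdmissibleIndex n c₁ M) k, 0 ≤ ckNorm (2 + k) (Dt p.1.2.1 p.1.2.2) :=
    fun p k => ckNorm_nonneg _ _
  have hc3 : ∀ (p : AdmissibleIndex n c₁ M) k, 0 ≤ ckNorm (1 + k) (Dts 2 p.1.2.1 p.1.2.2) :=
    fun p k => ckNorm_nonneg _ _
  simp only [mSlice] at hm
  rw [e]
  refine ⟨fun p => p.2.1.smooth.fderiv.clm_comp _, ?_, ?_, ?_⟩
  · refine tame_entry (fun p => p.2.1.smooth.contDiff_slice _) (fun p k => ?_) i a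
    have := ckNorm_mono (show 1 + k ≤ 3 + k by omega) (p.1.2.1 p.1.2.2)
    linarith [hm p k, hc1 p k, hc2 p k, hc3 p k]
  · have e2 := fun p : AdmissibleIndex n c₁ M => e1 _ p.2.1.smooth
    simp only [e2]
    refine tame_entry (fun p => p.2.1.smooth.Dt.contDiff_slice _) (fun p k => ?_) i a
    have := ckNorm_mono (show 1 + k ≤ 2 + k by omega) (Dt p.1.2.1 p.1.2.2)
    linarith [hm p k, hc1 p k, hc2 p k, hc3 p k]
  · have e2 := fun p : AdmissibleIndex n c₁ M => e1 _ p.2.1.smooth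
    have e3 := fun p : AdmissibleIndex n c₁ M => e1 _ p.2.1.smooth.Dt
    simp only [e2, e3]
    refine tame_entry (fun p => p.2.1.smooth.Dt.Dt.contDiff_slice _) (fun p k => ?_) i a
    have : ckNorm (1 + k) (Dt (Dt p.1.2.1) p.1.2.2) = ckNorm (1 + k) (Dts 2 p.1.2.1 p.1.2.2) := rfl
    linarith [hm p k, hc1 p k, hc2 p k, hc3 p k]

theorem tame_Dts_log_kappa (hn : 0 < n) (c₁ M : ℝ) :
    Tame (fun (p : AdmissibleIndex n c₁ M) k => Mdd p.1.1 p.1.2.1 k)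
      (fun p => Dts 2 (fun s z => Real.log (kappa (p.1.2.1 s) z)) p.1.2.2) := by
  refine Tame₂.tame_log (tameWeight_Mdd hn c₁ M)
    (u := fun p t y => kappa (p.1.2.1 t) y)
    (Tame₂.det (tameWeight_Mdd hn c₁ M) (M := fun p t y => jacM (p.1.2.1 t) y) tame₂_jacM)
    (c := (n.factorial * |c₁| ^ n + 1)⁻¹) (by positivity) fun p y hy => ?_
  have hy' : y ∈ Ball n := Metric.ball_subset_closedBall hy
  exact le_abs_kappa (p.2.1.coord _ p.2.2 y hy') (p.2.1.det_ne _ p.2.2 y hy')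

end Geometry

section PointwiseEstimate

open intervalIntegral in
theorem le_mul_exp_of_le_add_integral {e : ℝ → ℝ} (he : Continuous e) (h0 : ∀ t, 0 ≤ e t)
    {A C b : ℝ} (hC : 0 ≤ C) (h : ∀ t ∈ Icc 0 b, e t ≤ A + C * ∫ τ in (0 : ℝ)..t, e τ) :
    ∀ t ∈ Icc 0 b, e t ≤ A * Real.exp (C * t) := by
  have hE : ∀ t, HasDerivAt (fun t => ∫ τ in (0 : ℝ)..t, e τ) (e t) t := fun t =>
    integral_hasDerivAt_right (he.intervalIntegrable _ _) (he.stronglyMeasurableAtFilter _ _)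
      he.continuousAt
  have hE0 : ∀ t ∈ Icc 0 b, 0 ≤ ∫ τ in (0 : ℝ)..t, e τ := fun t ht =>
    integral_nonneg ht.1 fun τ _ => h0 τ
  have key := norm_le_gronwallBound_of_norm_deriv_right_le
    (f := fun t => ∫ τ in (0 : ℝ)..t, e τ) (f' := e) (δ := 0) (K := C) (ε := A) (a := 0) (b := b)
    (fun t _ => (hE t).continuousAt.continuousWithinAt)
    (fun t _ => (hE t).hasDerivWithinAt) (by simp)
    (fun t ht => by
      have ht' : t ∈ Icc 0 b := ⟨ht.1, ht.2.le⟩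
      rw [Real.norm_of_nonneg (h0 t), Real.norm_of_nonneg (hE0 t ht'), add_comm]
      exact h t ht')
  intro t ht
  have k := key t ht
  rw [Real.norm_of_nonneg (hE0 t ht), sub_zero] at k
  refine (h t ht).trans ?_
  rcases hC.eq_or_lt with h | h
  · simp [← h]
  · rw [gronwallBound_of_K_ne_0 h.ne'] at k
    have k2 := mul_le_mul_of_nonneg_left k hC
    have e2 : C * (0 * Real.exp (C * t) + A / C * (Real.exp (C * t) - 1)) =
        A * Real.exp (C * t) - A := by field_simp; ring
    simp only [e2] at k2
    linarith

/-- The data of the second order equation `D_t² φ + S φ = f` on the unit ball, with vanishing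
initial data, where the coefficient `S` is controlled by the weights `A`. -/
structure OscillatorData (c M : ℝ) (C : ℕ → ℝ) (D : ℕ → ℕ → ℝ) (T : ℝ) (A : ℕ → ℝ)
    (S φ f : ℝ → E' n → ℝ) : Prop where
  T_le : T ≤ 1
  smooth_sol : SmoothST φ
  smooth_rhs : SmoothST f
  nonneg : ∀ k, 0 ≤ A k
  lower : c ≤ A 0
  upper : A 0 ≤ M
  mul_le : ∀ a b, A a * A b ≤ D a b * A (a + b)
  smooth_coeff : ∀ t ∈ Icc 0 T, ContDiffOn ℝ (⊤ : ℕ∞) (S t) (Metric.ball 0 1)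
  bound : ∀ k, ∀ t ∈ Icc 0 T, ∀ y ∈ Metric.ball (0 : E' n) 1,
    ‖iteratedFDeriv ℝ k (S t) y‖ ≤ C k * A k
  eqn : ∀ t ∈ Icc 0 T, ∀ y ∈ Metric.ball (0 : E' n) 1, Dts 2 φ t y + S t y * φ t y = f t y
  init : ∀ y ∈ Metric.ball (0 : E' n) 1, φ 0 y = 0 ∧ Dt φ 0 y = 0

variable {c M T : ℝ} {C : ℕ → ℝ} {D : ℕ → ℕ → ℝ} {A : ℕ → ℝ} {S φ f : ℝ → E' n → ℝ}

theorem OscillatorData.norm_Dts_le (h : OscillatorData c M C D T A S φ f) (j : ℕ)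
    {t : ℝ} (ht : t ∈ Icc 0 T) {y : E' n} (hy : y ∈ Metric.ball (0 : E' n) 1) :
    ‖iteratedFDeriv ℝ j (Dts 2 φ t) y‖ ≤ ‖iteratedFDeriv ℝ j (f t) y‖ +
      ∑ a ∈ Finset.range (j + 1), (j.choose a * C (j - a)) * A (j - a) *
        ‖iteratedFDeriv ℝ a (φ t) y‖ := by
  have hB := Metric.isOpen_ball.mem_nhds hy
  have e : Dts 2 φ t =ᶠ[nhds y] f t - fun z => φ t z * S t z := by
    filter_upwards [hB] with z hz
    have := h.eqn t ht z hz
    simp only [Pi.sub_apply]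
    linarith
  have hφ := h.smooth_sol.contDiff_slice t
  have hm : ContDiffOn ℝ (⊤ : ℕ∞) (fun z => φ t z * S t z) (Metric.ball 0 1) :=
    hφ.contDiffOn.mul (h.smooth_coeff t ht)
  rw [(e.iteratedFDeriv ℝ j).eq_of_nhds, iteratedFDeriv_sub_apply
    ((h.smooth_rhs.contDiff_slice t).contDiffAt.of_le (by exact_mod_cast le_top))
    ((hm.contDiffAt hB).of_le (by exact_mod_cast le_top))]
  refine (norm_sub_le _ _).trans (add_le_add le_rfl ?_)
  have k := norm_iteratedFDerivWithin_mul_le hφ.contDiffOn (h.smooth_coeff t ht)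
    Metric.isOpen_ball.uniqueDiffOn hy (n := j) (by exact_mod_cast le_top)
  simp only [iteratedFDerivWithin_of_isOpen _ Metric.isOpen_ball hy] at k
  refine k.trans (Finset.sum_le_sum fun a _ => ?_)
  calc _ ≤ (j.choose a : ℝ) * ‖iteratedFDeriv ℝ a (φ t) y‖ * (C (j - a) * A (j - a)) := by
        gcongr
        exact h.bound _ t ht y hy
    _ = _ := by ring

theorem SmoothST.norm_le_integral {u : ℝ → E' n → ℝ} (hu : SmoothST u) {y : E' n}
    (h0 : u 0 =ᶠ[nhds y] 0) (j : ℕ) {t : ℝ} (ht : 0 ≤ t) :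
    ‖_root_.iteratedFDeriv ℝ j (u t) y‖ ≤
      ∫ τ in (0 : ℝ)..t, ‖_root_.iteratedFDeriv ℝ j (_root_.Dt u τ) y‖ := by
  have hc : Continuous fun τ => _root_.iteratedFDeriv ℝ j (_root_.Dt u τ) y :=
    ((hu.Dt.iteratedFDeriv j).1.contDiff_time y).continuous
  have h1 : _root_.iteratedFDeriv ℝ j (u 0) y = 0 := by
    rw [(h0.iteratedFDeriv ℝ j).eq_of_nhds]
    exact congrFun (iteratedFDeriv_fun_zero (𝕜 := ℝ) (n := j) (E := E' n) (F := ℝ)) y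
  have h2 := intervalIntegral.integral_eq_sub_of_hasDerivAt (a := 0) (b := t)
    (fun τ _ => hu.hasDerivAt_iteratedFDeriv j τ y) (hc.intervalIntegrable _ _)
  rw [h1, sub_zero] at h2
  rw [← h2]
  exact intervalIntegral.norm_integral_le_integral_norm ht

/-- Pointwise tame estimate for the solution of `D_t² φ + S φ = f`. -/
theorem OscillatorData.exists_pointwise (hc : 0 < c) (hC : ∀ k, 0 ≤ C k) (hD : ∀ a b, 0 ≤ D a b)
    (j : ℕ) :
    ∃ K, 0 ≤ K ∧ ∀ (T : ℝ) (A : ℕ → ℝ) (S φ f : ℝ → E' n → ℝ),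
      OscillatorData c M C D T A S φ f → ∀ t ∈ Icc 0 T, ∀ y ∈ Metric.ball (0 : E' n) 1,
      ‖iteratedFDeriv ℝ j (φ t) y‖ + ‖iteratedFDeriv ℝ j (Dt φ t) y‖ ≤
        K * ∑ s ∈ Finset.range (j + 1), A (j - s) *
          ∫ τ in (0 : ℝ)..t, ‖iteratedFDeriv ℝ s (f τ) y‖ := by
  induction j using Nat.strong_induction_on with
  | _ j ih =>
  have ih' : ∀ a, ∃ K, 0 ≤ K ∧ (a < j → ∀ (T : ℝ) (A : ℕ → ℝ) (S φ f : ℝ → E' n → ℝ),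
      OscillatorData c M C D T A S φ f → ∀ t ∈ Icc 0 T, ∀ y ∈ Metric.ball (0 : E' n) 1,
      ‖iteratedFDeriv ℝ a (φ t) y‖ + ‖iteratedFDeriv ℝ a (Dt φ t) y‖ ≤
        K * ∑ s ∈ Finset.range (a + 1), A (a - s) *
          ∫ τ in (0 : ℝ)..t, ‖iteratedFDeriv ℝ s (f τ) y‖) := by
    intro a
    by_cases ha : a < j
    · obtain ⟨K, hK, h⟩ := ih a ha
      exact ⟨K, hK, fun _ => h⟩
    · exact ⟨0, le_rfl, fun h => absurd h ha⟩
  choose K hK hK' using ih'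
  set L : ℕ → ℝ := fun a => j.choose a * C (j - a) * K a *
    ∑ s ∈ Finset.range (a + 1), D (j - a) (a - s) with hL
  have hL0 : ∀ a, 0 ≤ L a := fun a => mul_nonneg (mul_nonneg (mul_nonneg (Nat.cast_nonneg _)
    (hC _)) (hK a)) (Finset.sum_nonneg fun s _ => hD _ _)
  refine ⟨(1 / c + ∑ a ∈ Finset.range j, L a) * Real.exp (1 + C 0 * |M|),
    mul_nonneg (add_nonneg (by positivity) (Finset.sum_nonneg fun a _ => hL0 a))
      (Real.exp_pos _).le, fun T A S φ f h t ht y hy => ?_⟩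
  have hfc : ∀ s, Continuous fun τ => ‖iteratedFDeriv ℝ s (f τ) y‖ := fun s =>
    ((h.smooth_rhs.iteratedFDeriv s).1.contDiff_time y).continuous.norm
  have hφc : ∀ s, Continuous fun τ => ‖iteratedFDeriv ℝ s (φ τ) y‖ := fun s =>
    ((h.smooth_sol.iteratedFDeriv s).1.contDiff_time y).continuous.norm
  have hφt : ∀ s, Continuous fun τ => ‖iteratedFDeriv ℝ s (Dt φ τ) y‖ := fun s =>
    ((h.smooth_sol.Dt.iteratedFDeriv s).1.contDiff_time y).continuous.norm
  have hφtt : ∀ s, Continuous fun τ => ‖iteratedFDeriv ℝ s (Dt (Dt φ) τ) y‖ := fun s =>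
    ((h.smooth_sol.Dt.Dt.iteratedFDeriv s).1.contDiff_time y).continuous.norm
  set G : ℕ → ℝ := fun s => ∫ τ in (0 : ℝ)..t, ‖iteratedFDeriv ℝ s (f τ) y‖ with hG
  have hG0 : ∀ s, 0 ≤ G s := fun s =>
    intervalIntegral.integral_nonneg ht.1 fun _ _ => norm_nonneg _
  have hGmono : ∀ s, ∀ τ ∈ Icc 0 t, ∫ τ in (0 : ℝ)..τ, ‖iteratedFDeriv ℝ s (f τ) y‖ ≤ G s :=
    fun s τ hτ => intervalIntegral.integral_mono_interval le_rfl hτ.1 hτ.2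
      (Filter.Eventually.of_forall fun _ => norm_nonneg _) ((hfc s).intervalIntegrable _ _)
  set R : ℝ := ∑ s ∈ Finset.range (j + 1), A (j - s) * G s with hR
  have hAG : ∀ s ∈ Finset.range (j + 1), A (j - s) * G s ≤ R := fun s hs =>
    Finset.single_le_sum (f := fun s => A (j - s) * G s)
      (fun s _ => mul_nonneg (h.nonneg _) (hG0 s)) hs
  have hR0 : 0 ≤ R := Finset.sum_nonneg fun s _ => mul_nonneg (h.nonneg _) (hG0 s)
  have hlow : ∀ a ∈ Finset.range j, ∀ τ ∈ Icc 0 t,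
      (j.choose a * C (j - a)) * A (j - a) * ‖iteratedFDeriv ℝ a (φ τ) y‖ ≤ L a * R := by
    intro a ha τ hτ
    have ha' : a < j := Finset.mem_range.1 ha
    have h1 := hK' a ha' T A S φ f h τ ⟨hτ.1, hτ.2.trans ht.2⟩ y hy
    have h2 : ‖iteratedFDeriv ℝ a (φ τ) y‖ ≤
        K a * ∑ s ∈ Finset.range (a + 1), A (a - s) * G s := by
      refine (le_add_of_nonneg_right (norm_nonneg _)).trans (h1.trans ?_)
      refine mul_le_mul_of_nonneg_left (Finset.sum_le_sum fun s _ => ?_) (hK a)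
      exact mul_le_mul_of_nonneg_left (hGmono s τ hτ) (h.nonneg _)
    have h3 : A (j - a) * ∑ s ∈ Finset.range (a + 1), A (a - s) * G s ≤
        (∑ s ∈ Finset.range (a + 1), D (j - a) (a - s)) * R := by
      rw [Finset.mul_sum, Finset.sum_mul]
      refine Finset.sum_le_sum fun s hs => ?_
      have hs' : s ≤ a := Nat.lt_succ_iff.1 (Finset.mem_range.1 hs)
      have h4 := h.mul_le (j - a) (a - s)
      rw [show j - a + (a - s) = j - s by omega] at h4
      calc A (j - a) * (A (a - s) * G s) = A (j - a) * A (a - s) * G s := by ring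
        _ ≤ D (j - a) (a - s) * A (j - s) * G s := mul_le_mul_of_nonneg_right h4 (hG0 s)
        _ = D (j - a) (a - s) * (A (j - s) * G s) := by ring
        _ ≤ _ := mul_le_mul_of_nonneg_left (hAG s (Finset.mem_range.2 (by omega))) (hD _ _)
    have p1 : 0 ≤ (j.choose a : ℝ) * C (j - a) := mul_nonneg (Nat.cast_nonneg _) (hC _)
    calc _ ≤ (j.choose a * C (j - a)) * A (j - a) *
            (K a * ∑ s ∈ Finset.range (a + 1), A (a - s) * G s) :=
          mul_le_mul_of_nonneg_left h2 (mul_nonneg p1 (h.nonneg _))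
      _ = (j.choose a * C (j - a) * K a) *
            (A (j - a) * ∑ s ∈ Finset.range (a + 1), A (a - s) * G s) := by ring
      _ ≤ (j.choose a * C (j - a) * K a) *
            ((∑ s ∈ Finset.range (a + 1), D (j - a) (a - s)) * R) :=
          mul_le_mul_of_nonneg_left h3 (mul_nonneg p1 (hK a))
      _ = _ := by rw [hL]; ring
  set e : ℝ → ℝ := fun τ => ‖iteratedFDeriv ℝ j (φ τ) y‖ + ‖iteratedFDeriv ℝ j (Dt φ τ) y‖ with he
  have hec : Continuous e := (hφc j).add (hφt j)
  have he0 : ∀ τ, 0 ≤ e τ := fun τ => add_nonneg (norm_nonneg _) (norm_nonneg _)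
  have hB := Metric.isOpen_ball.mem_nhds hy
  have i0 : φ 0 =ᶠ[nhds y] 0 := by
    filter_upwards [hB] with z hz using (h.init z hz).1
  have i1 : Dt φ 0 =ᶠ[nhds y] 0 := by
    filter_upwards [hB] with z hz using (h.init z hz).2
  set Λ : ℝ := ∑ a ∈ Finset.range j, L a with hΛ
  have hΛ0 : 0 ≤ Λ := Finset.sum_nonneg fun a _ => hL0 a
  have hpt : ∀ τ ∈ Icc 0 t, ‖iteratedFDeriv ℝ j (Dt φ τ) y‖ +
      ‖iteratedFDeriv ℝ j (Dt (Dt φ) τ) y‖ ≤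
      ‖iteratedFDeriv ℝ j (f τ) y‖ + Λ * R + (1 + C 0 * |M|) * e τ := by
    intro τ hτ
    have h1 := h.norm_Dts_le j ⟨hτ.1, hτ.2.trans ht.2⟩ hy
    rw [Finset.sum_range_succ] at h1
    have h2 := Finset.sum_le_sum fun a ha => hlow a ha τ hτ
    rw [← Finset.sum_mul] at h2
    simp only [Nat.choose_self, Nat.cast_one, one_mul, Nat.sub_self] at h1
    have h3 : C 0 * A 0 * ‖iteratedFDeriv ℝ j (φ τ) y‖ ≤ C 0 * |M| * e τ := by
      refine mul_le_mul ?_ (le_add_of_nonneg_right (norm_nonneg _)) (norm_nonneg _)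
        (mul_nonneg (hC 0) (abs_nonneg _))
      exact mul_le_mul_of_nonneg_left (h.upper.trans (le_abs_self _)) (hC 0)
    have h4 : ‖iteratedFDeriv ℝ j (Dt φ τ) y‖ ≤ e τ := le_add_of_nonneg_left (norm_nonneg _)
    change ‖iteratedFDeriv ℝ j (Dt (Dt φ) τ) y‖ ≤ _ at h1
    linarith
  have hgr : ∀ τ ∈ Icc 0 t, e τ ≤ (1 / c + Λ) * R + (1 + C 0 * |M|) * ∫ σ in (0 : ℝ)..τ, e σ := by
    intro τ hτ
    have h1 := h.smooth_sol.norm_le_integral i0 j hτ.1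
    have h2 := h.smooth_sol.Dt.norm_le_integral i1 j hτ.1
    have h3 : ∫ σ in (0 : ℝ)..τ, (‖iteratedFDeriv ℝ j (Dt φ σ) y‖ +
        ‖iteratedFDeriv ℝ j (Dt (Dt φ) σ) y‖) ≤ ∫ σ in (0 : ℝ)..τ,
        (‖iteratedFDeriv ℝ j (f σ) y‖ + Λ * R + (1 + C 0 * |M|) * e σ) :=
      intervalIntegral.integral_mono_on hτ.1 (((hφt j).add (hφtt j)).intervalIntegrable _ _)
        ((((hfc j).add continuous_const).add (continuous_const.mul hec)).intervalIntegrable _ _)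
        fun σ hσ => hpt σ ⟨hσ.1, hσ.2.trans hτ.2⟩
    have i2 : Continuous fun σ => ‖iteratedFDeriv ℝ j (f σ) y‖ + Λ * R :=
      (hfc j).add continuous_const
    have i3 : Continuous fun σ => (1 + C 0 * |M|) * e σ := continuous_const.mul hec
    rw [intervalIntegral.integral_add ((hφt j).intervalIntegrable _ _)
      ((hφtt j).intervalIntegrable _ _),
      intervalIntegral.integral_add (i2.intervalIntegrable _ _) (i3.intervalIntegrable _ _),
      intervalIntegral.integral_add ((hfc j).intervalIntegrable _ _)
      (continuous_const.intervalIntegrable _ _), intervalIntegral.integral_const,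
      intervalIntegral.integral_const_mul, sub_zero, smul_eq_mul] at h3
    have h4 : ∫ σ in (0 : ℝ)..τ, ‖iteratedFDeriv ℝ j (f σ) y‖ ≤ 1 / c * R := by
      refine (hGmono j τ hτ).trans ?_
      rw [one_div, ← div_eq_inv_mul, le_div_iff₀ hc, mul_comm]
      refine (mul_le_mul_of_nonneg_right h.lower (hG0 j)).trans ?_
      simpa using hAG j (Finset.mem_range.2 (Nat.lt_succ_self j))
    have h5 : τ * (Λ * R) ≤ Λ * R :=
      mul_le_of_le_one_left (mul_nonneg hΛ0 hR0) ((hτ.2.trans ht.2).trans h.T_le)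
    linarith
  have hM : 0 ≤ 1 + C 0 * |M| := add_nonneg zero_le_one (mul_nonneg (hC 0) (abs_nonneg _))
  have hfin := le_mul_exp_of_le_add_integral hec he0 hM hgr t ⟨ht.1, le_rfl⟩
  refine hfin.trans ?_
  have h6 : Real.exp ((1 + C 0 * |M|) * t) ≤ Real.exp (1 + C 0 * |M|) :=
    Real.exp_le_exp.2 (mul_le_of_le_one_right hM (ht.2.trans h.T_le))
  calc _ ≤ (1 / c + Λ) * R * Real.exp (1 + C 0 * |M|) :=
        mul_le_mul_of_nonneg_left h6 (mul_nonneg (add_nonneg (by positivity) hΛ0) hR0)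
    _ = _ := by ring

end PointwiseEstimate

section L2Estimate

open MeasureTheory

/-- `L²` norm on the unit ball. -/
def l2Ball (g : E' n → ℝ) : ℝ := (∫ y in Ball n, g y ^ 2) ^ ((1 : ℝ) / 2)

theorem l2Ball_nonneg (g : E' n → ℝ) : 0 ≤ l2Ball g :=
  Real.rpow_nonneg (integral_nonneg fun _ => sq_nonneg _) _

theorem l2Ball_sq (g : E' n → ℝ) : l2Ball g ^ 2 = ∫ y in Ball n, g y ^ 2 := by
  rw [l2Ball, ← Real.sqrt_eq_rpow, Real.sq_sqrt (integral_nonneg fun _ => sq_nonneg _)]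

theorem integral_mul_le_l2Ball {g h : E' n → ℝ} (hg : Continuous g) (hh : Continuous h)
    (hg0 : ∀ y, 0 ≤ g y) (hh0 : ∀ y, 0 ≤ h y) :
    ∫ y in Ball n, g y * h y ≤ l2Ball g * l2Ball h := by
  have hL : ∀ k : E' n → ℝ, Continuous k →
      MemLp k (ENNReal.ofReal 2) (volume.restrict (Ball n)) := fun k hk => by
    rw [show ENNReal.ofReal 2 = 2 by simp, memLp_two_iff_integrable_sq hk.aestronglyMeasurable]
    exact (hk.pow 2).continuousOn.integrableOn_compact (isCompact_Ball n)
  have := integral_mul_le_Lp_mul_Lq_of_nonneg (μ := volume.restrict (Ball n))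
    Real.HolderConjugate.two_two (f := g) (g := h) (Filter.Eventually.of_forall hg0)
    (Filter.Eventually.of_forall hh0) (hL g hg) (hL h hh)
  simpa only [Real.rpow_two, l2Ball] using this

theorem l2Ball_le_of_integral_sq_le {h : E' n → ℝ} {B : ℝ} (hB : 0 ≤ B)
    (hh : ∫ y in Ball n, h y ^ 2 ≤ B * l2Ball h) : l2Ball h ≤ B := by
  rw [← l2Ball_sq, sq] at hh
  rcases (l2Ball_nonneg h).eq_or_lt with h0 | h0
  · rwa [← h0]
  · exact le_of_mul_le_mul_right hh h0

theorem l2Ball_le_sum {ι : Type*} (S : Finset ι) {h : E' n → ℝ} {g : ι → E' n → ℝ} {a : ι → ℝ}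
    (hc : Continuous h) (h0 : ∀ y, 0 ≤ h y) (gc : ∀ i, Continuous (g i)) (g0 : ∀ i y, 0 ≤ g i y)
    (a0 : ∀ i, 0 ≤ a i)
    (hle : ∀ y ∈ Metric.ball (0 : E' n) 1, h y ≤ ∑ i ∈ S, a i * g i y) :
    l2Ball h ≤ ∑ i ∈ S, a i * l2Ball (g i) := by
  have hsc : Continuous fun y => ∑ i ∈ S, a i * g i y :=
    continuous_finsetSum _ fun i _ => continuous_const.mul (gc i)
  have hle' : ∀ y ∈ Ball n, h y ≤ ∑ i ∈ S, a i * g i y := fun y hy =>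
    le_on_closure hle hc.continuousOn hsc.continuousOn
      (by rwa [closure_ball _ one_ne_zero])
  have hI : ∀ k : E' n → ℝ, Continuous k → IntegrableOn k (Ball n) := fun k hk =>
    hk.continuousOn.integrableOn_compact (isCompact_Ball n)
  refine l2Ball_le_of_integral_sq_le
    (Finset.sum_nonneg fun i _ => mul_nonneg (a0 i) (l2Ball_nonneg _)) ?_
  calc ∫ y in Ball n, h y ^ 2 ≤ ∫ y in Ball n, ∑ i ∈ S, a i * (g i y * h y) := by
        refine setIntegral_mono_on (hI _ (hc.pow 2))
          (hI _ (continuous_finsetSum _ fun i _ => continuous_const.mul ((gc i).mul hc)))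
          Metric.isClosed_closedBall.measurableSet fun y hy => ?_
        have := mul_le_mul_of_nonneg_right (hle' y hy) (h0 y)
        simpa only [sq, Finset.sum_mul, mul_assoc] using this
    _ = ∑ i ∈ S, a i * ∫ y in Ball n, g i y * h y := by
        rw [integral_finsetSum (f := fun i y => a i * (g i y * h y)) _
          fun i _ => hI _ (continuous_const.mul ((gc i).mul hc))]
        simp only [integral_const_mul]
    _ ≤ ∑ i ∈ S, a i * (l2Ball (g i) * l2Ball h) :=
        Finset.sum_le_sum fun i _ => mul_le_mul_of_nonneg_left
          (integral_mul_le_l2Ball (gc i) hc (g0 i) h0) (a0 i)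
    _ = _ := by simp only [Finset.sum_mul, mul_assoc]

variable {q : ℝ → E' n → ℝ}

theorem continuous_l2Ball (hq : Continuous fun p : ℝ × E' n => q p.1 p.2) :
    Continuous fun τ => l2Ball (q τ) :=
  have h : Continuous fun p : ℝ × E' n => q p.1 p.2 ^ 2 := hq.pow 2
  (continuous_parametric_integral_of_continuous (f := fun τ y => q τ y ^ 2) h
    (isCompact_Ball n)).rpow_const fun _ => Or.inr (by norm_num)

/-- Minkowski's integral inequality. -/
theorem l2Ball_integral_le (hq : Continuous fun p : ℝ × E' n => q p.1 p.2)
    (q0 : ∀ τ y, 0 ≤ q τ y) {t : ℝ} (ht : 0 ≤ t) :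
    l2Ball (fun y => ∫ τ in (0 : ℝ)..t, q τ y) ≤ ∫ τ in (0 : ℝ)..t, l2Ball (q τ) := by
  set h : E' n → ℝ := fun y => ∫ τ in (0 : ℝ)..t, q τ y with hh
  have hc : Continuous h :=
    intervalIntegral.continuous_parametric_intervalIntegral_of_continuous'
      (f := fun y τ => q τ y) (hq.comp continuous_swap) 0 t
  have h0 : ∀ y, 0 ≤ h y := fun y => intervalIntegral.integral_nonneg ht fun τ _ => q0 τ y
  have hqs : ∀ τ, Continuous (q τ) := fun τ => hq.comp (Continuous.prodMk_right τ)
  have hqh : Continuous fun p : ℝ × E' n => q p.1 p.2 * h p.2 := hq.mul (hc.comp continuous_snd)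
  refine l2Ball_le_of_integral_sq_le
    (intervalIntegral.integral_nonneg ht fun τ _ => l2Ball_nonneg _) ?_
  calc ∫ y in Ball n, h y ^ 2 = ∫ y in Ball n, ∫ τ in (0 : ℝ)..t, q τ y * h y := by
        congr 1
        funext y
        rw [intervalIntegral.integral_mul_const, sq]
    _ = ∫ τ in (0 : ℝ)..t, ∫ y in Ball n, q τ y * h y := by
        refine (intervalIntegral_integral_swap (f := fun τ y => q τ y * h y) ?_).symm
        rw [Measure.prod_restrict]
        refine IntegrableOn.mono_set (t := uIcc 0 t ×ˢ Ball n) ?_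
          (prod_mono uIoc_subset_uIcc Subset.rfl)
        exact hqh.continuousOn.integrableOn_compact (isCompact_uIcc.prod (isCompact_Ball n))
    _ ≤ ∫ τ in (0 : ℝ)..t, l2Ball (q τ) * l2Ball h := by
        refine intervalIntegral.integral_mono_on ht ?_ ?_
          fun τ _ => integral_mul_le_l2Ball (hqs τ) hc (q0 τ) h0
        · exact (continuous_parametric_integral_of_continuous (f := fun τ y => q τ y * h y) hqh
            (isCompact_Ball n)).intervalIntegrable _ _
        · exact ((continuous_l2Ball hq).mul continuous_const).intervalIntegrable _ _
    _ = _ := intervalIntegral.integral_mul_const _ _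

theorem sobNorm_eq_sum_l2Ball (r : ℕ) (u : E' n → F) :
    sobNorm r u = ∑ j ∈ Finset.range (r + 1), l2Ball fun y => ‖iteratedFDeriv ℝ j u y‖ := rfl

theorem l2Ball_le_sobNorm {r j : ℕ} (h : j ≤ r) (u : E' n → F) :
    l2Ball (fun y => ‖iteratedFDeriv ℝ j u y‖) ≤ sobNorm r u :=
  Finset.single_le_sum (f := fun j => l2Ball fun y => ‖iteratedFDeriv ℝ j u y‖)
    (fun _ _ => l2Ball_nonneg _) (Finset.mem_range.2 (Nat.lt_succ_of_le h))

theorem sobNorm_nonneg (r : ℕ) (u : E' n → F) : 0 ≤ sobNorm r u :=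
  Finset.sum_nonneg fun _ _ => l2Ball_nonneg _

theorem SmoothST.continuous_slice_norm {u : ℝ → E' n → F} (hu : SmoothST u) (j : ℕ) (t : ℝ) :
    Continuous fun y => ‖_root_.iteratedFDeriv ℝ j (u t) y‖ :=
  (hu.continuous_norm_iteratedFDeriv j).comp (Continuous.prodMk_right t)

theorem SmoothST.continuous_sobNorm {u : ℝ → E' n → F} (hu : SmoothST u) (r : ℕ) :
    Continuous fun t => sobNorm r (u t) :=
  continuous_finsetSum _ fun j _ => continuous_l2Ball
    (q := fun t y => ‖_root_.iteratedFDeriv ℝ j (u t) y‖) (hu.continuous_norm_iteratedFDeriv j)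

variable {c M T : ℝ} {C : ℕ → ℝ} {D : ℕ → ℕ → ℝ} {A : ℕ → ℝ} {S φ f : ℝ → E' n → ℝ}

theorem exists_l2Ball_le (hc : 0 < c) (hC : ∀ k, 0 ≤ C k) (hD : ∀ a b, 0 ≤ D a b) (j : ℕ) :
    ∃ K, 0 ≤ K ∧ ∀ (T : ℝ) (A : ℕ → ℝ) (S φ f : ℝ → E' n → ℝ),
      OscillatorData c M C D T A S φ f → ∀ t ∈ Icc 0 T,
      l2Ball (fun y => ‖iteratedFDeriv ℝ j (φ t) y‖) ≤
        K * ∑ s ∈ Finset.range (j + 1), A (j - s) * ∫ τ in (0 : ℝ)..t, sobNorm s (f τ) ∧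
      l2Ball (fun y => ‖iteratedFDeriv ℝ j (Dt φ t) y‖) ≤
        K * ∑ s ∈ Finset.range (j + 1), A (j - s) * ∫ τ in (0 : ℝ)..t, sobNorm s (f τ) := by
  obtain ⟨K, hK, hp⟩ := OscillatorData.exists_pointwise (n := n) (M := M) hc hC hD j
  refine ⟨K, hK, fun T A S φ f h t ht => ?_⟩
  have main : ∀ u : E' n → ℝ, Continuous u → (∀ y, 0 ≤ u y) →
      (∀ y ∈ Metric.ball (0 : E' n) 1, u y ≤ K * ∑ s ∈ Finset.range (j + 1), A (j - s) *
          ∫ τ in (0 : ℝ)..t, ‖iteratedFDeriv ℝ s (f τ) y‖) →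
      l2Ball u ≤
        K * ∑ s ∈ Finset.range (j + 1), A (j - s) * ∫ τ in (0 : ℝ)..t, sobNorm s (f τ) := by
    intro u uc u0 hu
    have hf := fun s => h.smooth_rhs.continuous_norm_iteratedFDeriv s
    refine (l2Ball_le_sum (Finset.range (j + 1)) (a := fun s => K * A (j - s))
      (g := fun s y => ∫ τ in (0 : ℝ)..t, ‖iteratedFDeriv ℝ s (f τ) y‖) uc u0
      (fun s => intervalIntegral.continuous_parametric_intervalIntegral_of_continuous'
        (f := fun y τ => ‖iteratedFDeriv ℝ s (f τ) y‖) ((hf s).comp continuous_swap) 0 t)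
      (fun s y => intervalIntegral.integral_nonneg ht.1 fun _ _ => norm_nonneg _)
      (fun s => mul_nonneg hK (h.nonneg _)) fun y hy => ?_).trans ?_
    · simpa only [Finset.mul_sum, mul_assoc] using hu y hy
    · simp only [Finset.mul_sum, ← mul_assoc]
      refine Finset.sum_le_sum fun s _ =>
        mul_le_mul_of_nonneg_left ?_ (mul_nonneg hK (h.nonneg _))
      refine (l2Ball_integral_le (q := fun τ y => ‖iteratedFDeriv ℝ s (f τ) y‖) (hf s)
        (fun _ _ => norm_nonneg _) ht.1).trans ?_
      exact intervalIntegral.integral_mono_on ht.1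
        ((continuous_l2Ball (hf s)).intervalIntegrable _ _)
        ((h.smooth_rhs.continuous_sobNorm s).intervalIntegrable _ _)
        fun τ _ => l2Ball_le_sobNorm le_rfl _
  refine ⟨main _ (h.smooth_sol.continuous_slice_norm j t) (fun _ => norm_nonneg _) fun y hy => ?_,
    main _ (h.smooth_sol.Dt.continuous_slice_norm j t) (fun _ => norm_nonneg _) fun y hy => ?_⟩
  · exact (le_add_of_nonneg_right (norm_nonneg _)).trans (hp T A S φ f h t ht y hy)
  · exact (le_add_of_nonneg_left (norm_nonneg _)).trans (hp T A S φ f h t ht y hy)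

theorem exists_l2Ball_Dts_le (hc : 0 < c) (hC : ∀ k, 0 ≤ C k) (hD : ∀ a b, 0 ≤ D a b) (j : ℕ) :
    ∃ K, 0 ≤ K ∧ ∀ (T : ℝ) (A : ℕ → ℝ) (S φ f : ℝ → E' n → ℝ),
      OscillatorData c M C D T A S φ f → ∀ t ∈ Icc 0 T,
      l2Ball (fun y => ‖iteratedFDeriv ℝ j (Dts 2 φ t) y‖) ≤
        K * ∑ s ∈ Finset.range (j + 1), A (j - s) *
          (sobNorm s (f t) + ∫ τ in (0 : ℝ)..t, sobNorm s (f τ)) := by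
  choose K hK hp using fun a => exists_l2Ball_le (n := n) (M := M) hc hC hD a
  set L : ℕ → ℝ := fun a => j.choose a * C (j - a) * K a *
    ∑ s ∈ Finset.range (a + 1), D (j - a) (a - s) with hL
  have hL0 : ∀ a, 0 ≤ L a := fun a => mul_nonneg (mul_nonneg (mul_nonneg (Nat.cast_nonneg _)
    (hC _)) (hK a)) (Finset.sum_nonneg fun s _ => hD _ _)
  refine ⟨1 / c + ∑ a ∈ Finset.range (j + 1), L a,
    add_nonneg (by positivity) (Finset.sum_nonneg fun a _ => hL0 a), fun T A S φ f h t ht => ?_⟩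
  set G : ℕ → ℝ := fun s => ∫ τ in (0 : ℝ)..t, sobNorm s (f τ) with hG
  have hG0 : ∀ s, 0 ≤ G s := fun s =>
    intervalIntegral.integral_nonneg ht.1 fun _ _ => sobNorm_nonneg _ _
  set R : ℝ := ∑ s ∈ Finset.range (j + 1), A (j - s) * (sobNorm s (f t) + G s) with hR
  have hAR : ∀ s ∈ Finset.range (j + 1), A (j - s) * (sobNorm s (f t) + G s) ≤ R := fun s hs =>
    Finset.single_le_sum (f := fun s => A (j - s) * (sobNorm s (f t) + G s))
      (fun s _ => mul_nonneg (h.nonneg _) (add_nonneg (sobNorm_nonneg _ _) (hG0 s))) hs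
  have h1 := l2Ball_le_sum (Finset.insertNone (Finset.range (j + 1)))
    (h := fun y => ‖iteratedFDeriv ℝ j (Dts 2 φ t) y‖)
    (g := fun o y => Option.elim o ‖iteratedFDeriv ℝ j (f t) y‖ fun a =>
      ‖iteratedFDeriv ℝ a (φ t) y‖)
    (a := fun o => Option.elim o 1 fun a => (j.choose a * C (j - a)) * A (j - a))
    (h.smooth_sol.Dt.Dt.continuous_slice_norm j t) (fun _ => norm_nonneg _)
    (fun o => by
      cases o
      · exact h.smooth_rhs.continuous_slice_norm j t
      · exact h.smooth_sol.continuous_slice_norm _ t)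
    (fun o y => by cases o <;> exact norm_nonneg _)
    (fun o => by
      cases o
      · exact zero_le_one
      · exact mul_nonneg (mul_nonneg (Nat.cast_nonneg _) (hC _)) (h.nonneg _))
    (fun y hy => by simpa [Finset.sum_insertNone] using h.norm_Dts_le j ht hy)
  simp only [Finset.sum_insertNone, Option.elim_none, Option.elim_some, one_mul] at h1
  refine h1.trans ?_
  rw [add_mul, Finset.sum_mul]
  refine add_le_add ?_ (Finset.sum_le_sum fun a ha => ?_)
  · rw [one_div, ← div_eq_inv_mul, le_div_iff₀ hc, mul_comm]
    refine le_trans ?_ (hAR j (Finset.mem_range.2 (Nat.lt_succ_self j)))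
    rw [Nat.sub_self]
    exact mul_le_mul h.lower ((l2Ball_le_sobNorm le_rfl _).trans
      (le_add_of_nonneg_right (hG0 j))) (l2Ball_nonneg _) (h.nonneg _)
  · have ha' : a ≤ j := Nat.lt_succ_iff.1 (Finset.mem_range.1 ha)
    have h3 : A (j - a) * ∑ s ∈ Finset.range (a + 1), A (a - s) * G s ≤
        (∑ s ∈ Finset.range (a + 1), D (j - a) (a - s)) * R := by
      rw [Finset.mul_sum, Finset.sum_mul]
      refine Finset.sum_le_sum fun s hs => ?_
      have hs' : s ≤ a := Nat.lt_succ_iff.1 (Finset.mem_range.1 hs)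
      have h4 := h.mul_le (j - a) (a - s)
      rw [show j - a + (a - s) = j - s by omega] at h4
      calc A (j - a) * (A (a - s) * G s) = A (j - a) * A (a - s) * G s := by ring
        _ ≤ D (j - a) (a - s) * A (j - s) * G s := mul_le_mul_of_nonneg_right h4 (hG0 s)
        _ = D (j - a) (a - s) * (A (j - s) * G s) := by ring
        _ ≤ D (j - a) (a - s) * R := by
            refine mul_le_mul_of_nonneg_left (le_trans ?_
              (hAR s (Finset.mem_range.2 (by omega)))) (hD _ _)
            exact mul_le_mul_of_nonneg_left (le_add_of_nonneg_left (sobNorm_nonneg _ _))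
              (h.nonneg _)
    have p1 : 0 ≤ (j.choose a : ℝ) * C (j - a) := mul_nonneg (Nat.cast_nonneg _) (hC _)
    calc _ ≤ (j.choose a * C (j - a)) * A (j - a) *
            (K a * ∑ s ∈ Finset.range (a + 1), A (a - s) * G s) :=
          mul_le_mul_of_nonneg_left (hp a T A S φ f h t ht).1 (mul_nonneg p1 (h.nonneg _))
      _ = (j.choose a * C (j - a) * K a) *
            (A (j - a) * ∑ s ∈ Finset.range (a + 1), A (a - s) * G s) := by ring
      _ ≤ (j.choose a * C (j - a) * K a) *
            ((∑ s ∈ Finset.range (a + 1), D (j - a) (a - s)) * R) :=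
          mul_le_mul_of_nonneg_left h3 (mul_nonneg p1 (hK a))
      _ = _ := by rw [hL]; ring

theorem sobNorm_le_of_l2Ball_le {r : ℕ} (hr : 1 ≤ r) (hA : ∀ k, 0 ≤ A k) (hmono : Monotone A)
    {K X : ℕ → ℝ} (hK : ∀ j, 0 ≤ K j) (hX : ∀ s, 0 ≤ X s) {u : E' n → F}
    (h : ∀ j, l2Ball (fun y => ‖iteratedFDeriv ℝ j u y‖) ≤
      K j * ∑ s ∈ Finset.range (j + 1), A (j - s) * X s) :
    sobNorm (r - 1) u ≤
      (∑ j ∈ Finset.range r, K j) * ∑ s ∈ Finset.range r, A (r - 1 - s) * X s := by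
  rw [sobNorm_eq_sum_l2Ball, Nat.sub_add_cancel hr, Finset.sum_mul]
  refine Finset.sum_le_sum fun j hj => (h j).trans (mul_le_mul_of_nonneg_left ?_ (hK j))
  have hj' := Finset.mem_range.1 hj
  refine (Finset.sum_le_sum fun s _ => mul_le_mul_of_nonneg_right
    (hmono (show j - s ≤ r - 1 - s by omega)) (hX s)).trans ?_
  exact Finset.sum_le_sum_of_subset_of_nonneg (Finset.range_subset_range.2 hj')
    fun s _ _ => mul_nonneg (hA _) (hX s)

end L2Estimate

theorem Admissible.oscillatorData (hn : 0 < n) {c₁ M T : ℝ} (hT : T < 1) {x : ℝ → E' n → E' n}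
    (hx : Admissible c₁ M T x) {φ f : ℝ → E' n → ℝ} (hφ : SmoothST φ) (hf : SmoothST f) {C : ℕ → ℝ}
    (hC : ∀ k (p : AdmissibleIndex n c₁ M), ∀ y ∈ Metric.ball (0 : E' n) 1,
      ‖iteratedFDeriv ℝ k (Dts 2 (fun s z => Real.log (kappa (p.1.2.1 s) z)) p.1.2.2) y‖ ≤
        C k * Mdd p.1.1 p.1.2.1 k)
    (eqn : ∀ t ∈ Icc (0 : ℝ) T, ∀ y ∈ Ball n,
      Dts 2 φ t y + Dts 2 (fun s z => Real.log (kappa (x s) z)) t y * φ t y = f t y)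
    (init : ∀ y ∈ Ball n, φ 0 y = 0 ∧ Dt φ 0 y = 0) :
    OscillatorData (n * |c₁| + 1)⁻¹ M C (fun a b => 3078 ^ (a * b) * |M|) T (Mdd T x)
      (Dts 2 fun s z => Real.log (kappa (x s) z)) φ f where
  T_le := hT.le
  smooth_sol := hφ
  smooth_rhs := hf
  nonneg := Mdd_nonneg T x
  lower := hx.le_Mdd_zero hn
  upper := hx.Mdd_le
  mul_le a b := by
    refine (hx.Mdd_mul_le hn a b).trans ?_
    have := Mdd_nonneg T x (a + b)
    gcongr
    exact le_abs_self M
  smooth_coeff t ht := (tame_Dts_log_kappa hn c₁ M).smooth ⟨(T, x, t), hx, ht⟩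
  bound k t ht y hy := hC k ⟨(T, x, t), hx, ht⟩ y hy
  eqn t ht y hy := eqn t ht y (Metric.ball_subset_closedBall hy)
  init y hy := init y (Metric.ball_subset_closedBall hy)

/-- tame estimates for the ordinary differential equation governing
the divergence (Lemma 12.2). -/
theorem stmt15 (n : ℕ) (hn : 2 ≤ n) (r : ℕ) (hr : 1 ≤ r) (c₁ M : ℝ) :
    ∃ K > 0, ∀ (T : ℝ) (x : ℝ → E' n → E' n) (φ f : ℝ → E' n → ℝ),
      0 < T → T < 1 → SmoothST x → SmoothST φ → SmoothST f →
      (∀ t ∈ Icc (0:ℝ) T, ∀ y ∈ Ball n, (jacM (x t) y).det ≠ 0) →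
      (∀ t ∈ Icc (0:ℝ) T, ∀ y ∈ Ball n, coordCond (x t) c₁ y) →
      (∀ t ∈ Icc (0:ℝ) T, ∀ y ∈ Ball n,
        Dts 2 φ t y + Dts 2 (fun s z => Real.log (kappa (x s) z)) t y * φ t y = f t y) →
      (∀ y ∈ Ball n, φ 0 y = 0 ∧ Dt φ 0 y = 0) →
      Mdd T x 0 ≤ M →
      ∀ t ∈ Icc (0:ℝ) T,
        (sobNorm (r - 1) (Dt φ t) + sobNorm (r - 1) (φ t) ≤
          K * ∑ s ∈ Finset.range r, Mdd T x (r - 1 - s) * ∫ τ in (0:ℝ)..t, sobNorm s (f τ)) ∧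
        (sobNorm (r - 1) (Dts 2 φ t) ≤
          K * ∑ s ∈ Finset.range r, Mdd T x (r - 1 - s) *
            (sobNorm s (f t) + ∫ τ in (0:ℝ)..t, sobNorm s (f τ))) := by
  have hn0 : 0 < n := by omega
  choose C hC0 hC using (tame_Dts_log_kappa hn0 c₁ M).bound
  have hc : (0 : ℝ) < (n * |c₁| + 1)⁻¹ := by positivity
  have hD : ∀ a b : ℕ, (0 : ℝ) ≤ 3078 ^ (a * b) * |M| := fun a b => by positivity
  choose K₁ hK₁ h₁ using fun j => exists_l2Ball_le (n := n) (M := M) hc hC0 hD j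
  choose K₂ hK₂ h₂ using fun j => exists_l2Ball_Dts_le (n := n) (M := M) hc hC0 hD j
  have p₁ : 0 ≤ ∑ j ∈ Finset.range r, K₁ j := Finset.sum_nonneg fun j _ => hK₁ j
  have p₂ : 0 ≤ ∑ j ∈ Finset.range r, K₂ j := Finset.sum_nonneg fun j _ => hK₂ j
  refine ⟨2 * ∑ j ∈ Finset.range r, K₁ j + ∑ j ∈ Finset.range r, K₂ j + 1, by linarith,
    fun T x φ f hT0 hT1 hx hφ hf hdet hcoord eqn init hM t ht => ?_⟩
  have hadm : Admissible c₁ M T x := ⟨hT0, hx, hdet, hcoord, hM⟩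
  have data := hadm.oscillatorData hn0 hT1 hφ hf (fun k p y hy => hC k p y hy) eqn init
  have hmono : Monotone (Mdd T x) := fun a b h => Mdd_mono hx h
  have hG : ∀ s, 0 ≤ ∫ τ in (0 : ℝ)..t, sobNorm s (f τ) := fun s =>
    intervalIntegral.integral_nonneg ht.1 fun _ _ => sobNorm_nonneg _ _
  have hG' : ∀ s, 0 ≤ sobNorm s (f t) + ∫ τ in (0 : ℝ)..t, sobNorm s (f τ) := fun s =>
    add_nonneg (sobNorm_nonneg _ _) (hG s)
  constructor
  · have e₁ := sobNorm_le_of_l2Ball_le hr (Mdd_nonneg T x) hmono hK₁ hG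
      (u := φ t) fun j => (h₁ j _ _ _ _ _ data t ht).1
    have e₂ := sobNorm_le_of_l2Ball_le hr (Mdd_nonneg T x) hmono hK₁ hG
      (u := Dt φ t) fun j => (h₁ j _ _ _ _ _ data t ht).2
    refine (add_le_add e₂ e₁).trans ?_
    rw [← add_mul]
    refine mul_le_mul_of_nonneg_right (by linarith)
      (Finset.sum_nonneg fun s _ => mul_nonneg (Mdd_nonneg _ _ _) (hG s))
  · refine (sobNorm_le_of_l2Ball_le hr (Mdd_nonneg T x) hmono hK₂ hG'
      (u := Dts 2 φ t) fun j => h₂ j _ _ _ _ _ data t ht).trans ?_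
    exact mul_le_mul_of_nonneg_right (by linarith)
      (Finset.sum_nonneg fun s _ => mul_nonneg (Mdd_nonneg _ _ _) (hG' s))

end
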